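/- arXiv:0709.0855 — 5 statements merged into one kernel-verified Lean document; each statement's English description precedes it below -/
import Mathlib

section
/- Let A_1,…,A_K be positive semidefinite d×d complex matrices, let B_1,…,B_K be arbitrary m×m complex matrices, and let q ≥ 1. Then ‖Σ_{k=1}^K A_k ⊗ B_k‖_q ≤ ‖Σ_{k=1}^K A_k‖_q · max_{1≤j≤K} ‖B_j‖_q. -/
open scoped Kronecker ComplexOrder
open Matrix

/-- The Schatten `q`-norm of a complex matrix `A`, i.e. `(Tr((A† A)^{q/2}))^{1/q}`,
computed via the eigenvalues of `Aᴴ * A` (the squares of the singular values of `A`). -/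
noncomputable def schattenNorm {m n : Type*} [Fintype m] [Fintype n] [DecidableEq n]
    (q : ℝ) (A : Matrix m n ℂ) : ℝ :=
  (∑ i, (Matrix.posSemidef_conjTranspose_mul_self A).1.eigenvalues i ^ (q / 2)) ^ (1 / q)

section SchattenAux

open scoped Matrix.Norms.L2Operator

variable {l m n p r : Type*} [Fintype l] [Fintype m] [Fintype n] [Fintype p] [Fintype r]
  [DecidableEq l] [DecidableEq m] [DecidableEq n] [DecidableEq p] [DecidableEq r]

/-- The singular values of a complex matrix, indexed by its columns. -/
noncomputable def singularValue (M : Matrix m n ℂ) (i : n) : ℝ :=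
  √((posSemidef_conjTranspose_mul_self M).1.eigenvalues i)

omit [DecidableEq m] in
lemma singularValue_nonneg (M : Matrix m n ℂ) (i : n) : 0 ≤ singularValue M i :=
  Real.sqrt_nonneg _

omit [DecidableEq m] in
lemma singularValue_sq (M : Matrix m n ℂ) (i : n) :
    singularValue M i ^ 2 = (posSemidef_conjTranspose_mul_self M).1.eigenvalues i :=
  Real.sq_sqrt ((posSemidef_conjTranspose_mul_self M).eigenvalues_nonneg i)

omit [DecidableEq m] in
lemma schattenNorm_eq_singularValue (q : ℝ) (M : Matrix m n ℂ) :
    schattenNorm q M = (∑ i, singularValue M i ^ q) ^ (1 / q) := by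
  unfold schattenNorm
  congr 1
  refine Finset.sum_congr rfl fun i _ => ?_
  have h := (posSemidef_conjTranspose_mul_self M).eigenvalues_nonneg i
  rw [singularValue, Real.sqrt_eq_rpow, ← Real.rpow_mul h]
  congr 1
  ring

omit [DecidableEq m] in
lemma schattenNorm_nonneg (q : ℝ) (M : Matrix m n ℂ) : 0 ≤ schattenNorm q M := by
  rw [schattenNorm_eq_singularValue]
  exact Real.rpow_nonneg
    (Finset.sum_nonneg fun i _ => Real.rpow_nonneg (singularValue_nonneg M i) _) _

omit [DecidableEq m] in
lemma schattenNorm_rpow {q : ℝ} (hq : 0 < q) (M : Matrix m n ℂ) :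
    schattenNorm q M ^ q = ∑ i, singularValue M i ^ q := by
  rw [schattenNorm_eq_singularValue, one_div, Real.rpow_inv_rpow _ hq.ne']
  exact Finset.sum_nonneg fun i _ => Real.rpow_nonneg (singularValue_nonneg M i) _

omit [DecidableEq m] in
/-- Singular value decomposition with a partial isometry as left factor. -/
lemma exists_singularValue_decomposition (M : Matrix m n ℂ) :
    ∃ (U : Matrix m n ℂ) (V : Matrix n n ℂ), Vᴴ * V = 1 ∧ V * Vᴴ = 1 ∧
      M = U * diagonal (fun i => (singularValue M i : ℂ)) * Vᴴ ∧
      Uᴴ * U = diagonal (fun i => if singularValue M i = 0 then 0 else 1) := by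
  set hM := (posSemidef_conjTranspose_mul_self M).1
  set V : Matrix n n ℂ := hM.eigenvectorUnitary.1
  have h1 : Vᴴ * V = 1 := Unitary.coe_star_mul_self hM.eigenvectorUnitary
  have h2 : V * Vᴴ = 1 := Unitary.coe_mul_star_self hM.eigenvectorUnitary
  have hs : Vᴴ * (Mᴴ * M) * V = diagonal (fun i => (singularValue M i : ℂ) ^ 2) := by
    have := hM.conjStarAlgAut_star_eigenvectorUnitary
    rw [Unitary.conjStarAlgAut_star_apply] at this
    refine this.trans ?_
    congr 1
    ext i
    simp only [Function.comp_apply]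
    rw [← Complex.ofReal_pow, singularValue_sq]
    rfl
  have key (f g : n → ℝ) : (M * V * diagonal (fun i => (f i : ℂ)))ᴴ *
      (M * V * diagonal (fun i => (g i : ℂ))) =
      diagonal (fun i => (f i : ℂ) * (singularValue M i : ℂ) ^ 2 * g i) := by
    have : (M * V * diagonal (fun i => (f i : ℂ)))ᴴ * (M * V * diagonal (fun i => (g i : ℂ))) =
        diagonal (fun i => (f i : ℂ)) * (Vᴴ * (Mᴴ * M) * V) * diagonal (fun i => (g i : ℂ)) := by
      simp only [conjTranspose_mul, diagonal_conjTranspose, Matrix.mul_assoc]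
      congr 2
      ext i
      simp
    rw [this, hs, diagonal_mul_diagonal, diagonal_mul_diagonal]
  refine ⟨M * V * diagonal (fun i => (((singularValue M i)⁻¹ : ℝ) : ℂ)), V, h1, h2, ?_, ?_⟩
  · have h0 : M * V * diagonal (fun i => ((1 - (singularValue M i)⁻¹ * singularValue M i : ℝ) : ℂ))
        = 0 := by
      rw [← conjTranspose_mul_self_eq_zero, key]
      ext i j
      rw [diagonal_apply]
      split_ifs with h
      · by_cases hz : singularValue M i = 0
        · simp [hz]
        · simp [inv_mul_cancel₀ hz]
      · rfl
    have h3 : M * V = M * V * diagonal (fun i => (((singularValue M i)⁻¹ : ℝ) : ℂ)) *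
        diagonal (fun i => (singularValue M i : ℂ)) := by
      rw [Matrix.mul_assoc _ (diagonal _) (diagonal _), diagonal_mul_diagonal, ← sub_eq_zero,
        ← h0]
      nth_rewrite 1 [← Matrix.mul_one (M * V)]
      rw [← Matrix.mul_sub, ← diagonal_one, diagonal_sub]
      simp
    rw [← h3, Matrix.mul_assoc, h2, Matrix.mul_one]
  · rw [key]
    congr 1
    ext i
    split_ifs with h
    · simp [h]
    · have : (singularValue M i : ℂ) ≠ 0 := by exact_mod_cast h
      push_cast
      field_simp

omit [DecidableEq m] in
lemma norm_le_one_of_conjTranspose_mul_self {M : Matrix m n ℂ} {f : n → ℂ}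
    (h : Mᴴ * M = diagonal f) (hf : ∀ i, ‖f i‖ ≤ 1) : ‖M‖ ≤ 1 := by
  have h1 : ‖M‖ * ‖M‖ ≤ 1 := by
    rw [← l2_opNorm_conjTranspose_mul_self, h, l2_opNorm_diagonal]
    exact (pi_norm_le_iff_of_nonneg zero_le_one).2 hf
  nlinarith [norm_nonneg M]

omit [Fintype p] [DecidableEq m] [DecidableEq p] in
lemma sum_norm_sq_mul_col_le (M : Matrix m n ℂ) (Z : Matrix n p ℂ) (j : p) :
    ∑ i, ‖(M * Z) i j‖ ^ 2 ≤ ‖M‖ ^ 2 * ∑ i, ‖Z i j‖ ^ 2 := by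
  have h := l2_opNorm_mulVec M (WithLp.toLp 2 fun i => Z i j)
  have h2 := pow_le_pow_left₀ (norm_nonneg _) h 2
  rw [mul_pow, EuclideanSpace.norm_sq_eq, EuclideanSpace.norm_sq_eq] at h2
  exact h2

omit [Fintype p] [DecidableEq p] in
lemma sum_norm_sq_mul_row_le (M : Matrix m n ℂ) (Z : Matrix p m ℂ) (j : p) :
    ∑ i, ‖(Z * M) j i‖ ^ 2 ≤ ‖M‖ ^ 2 * ∑ i, ‖Z j i‖ ^ 2 := by
  have h := sum_norm_sq_mul_col_le Mᴴ Zᴴ j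
  rw [← conjTranspose_mul, l2_opNorm_conjTranspose] at h
  simpa only [conjTranspose_apply, norm_star] using h

omit [DecidableEq m] in
lemma sum_norm_sq_col_le (M : Matrix m n ℂ) (j : n) : ∑ i, ‖M i j‖ ^ 2 ≤ ‖M‖ ^ 2 := by
  have h := sum_norm_sq_mul_col_le M 1 j
  have h1 : ∑ i, ‖(1 : Matrix n n ℂ) i j‖ ^ 2 = 1 := by
    rw [Finset.sum_eq_single j] <;> simp +contextual
  rwa [h1, mul_one, Matrix.mul_one] at h

omit [DecidableEq m] in
lemma norm_apply_le_l2_opNorm (M : Matrix m n ℂ) (i : m) (j : n) : ‖M i j‖ ≤ ‖M‖ :=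
  (pow_le_pow_iff_left₀ (norm_nonneg _) (norm_nonneg _) two_ne_zero).1
    ((Finset.single_le_sum (f := fun i => ‖M i j‖ ^ 2)
    (fun _ _ => sq_nonneg _) (Finset.mem_univ i)).trans (sum_norm_sq_col_le M j))

/-- Complex powers with the convention `0 ^ z = 0`, also at `z = 0`. -/
noncomputable def maskedCpow (x : ℝ) (z : ℂ) : ℂ := if x = 0 then 0 else (x : ℂ) ^ z

lemma norm_maskedCpow_le {x : ℝ} (hx : 0 ≤ x) {z : ℂ} (h0 : 0 ≤ z.re) (h1 : z.re ≤ 1) :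
    ‖maskedCpow x z‖ ≤ 1 + x := by
  unfold maskedCpow
  split_ifs with h
  · simp [h]
  · have hx' : 0 < x := lt_of_le_of_ne hx (Ne.symm h)
    rw [Complex.norm_cpow_eq_rpow_re_of_pos hx']
    rcases le_total x 1 with h | h
    · linarith [Real.rpow_le_one hx h h0]
    · have := Real.rpow_le_rpow_of_exponent_le h h1
      rw [Real.rpow_one] at this
      linarith

lemma norm_maskedCpow_le_one {x : ℝ} (hx : 0 ≤ x) {z : ℂ} (hz : z.re = 0) :
    ‖maskedCpow x z‖ ≤ 1 := by
  unfold maskedCpow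
  split_ifs with h
  · simp
  · rw [Complex.norm_cpow_eq_rpow_re_of_pos (lt_of_le_of_ne hx (Ne.symm h)), hz, Real.rpow_zero]

lemma norm_maskedCpow_of_re_eq_one {x : ℝ} (hx : 0 ≤ x) {z : ℂ} (hz : z.re = 1) :
    ‖maskedCpow x z‖ = x := by
  unfold maskedCpow
  split_ifs with h
  · simp [h]
  · rw [Complex.norm_cpow_eq_rpow_re_of_pos (lt_of_le_of_ne hx (Ne.symm h)), hz, Real.rpow_one]

lemma differentiable_maskedCpow (x : ℝ) : Differentiable ℂ (maskedCpow x) := by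
  unfold maskedCpow
  split_ifs with h
  · exact differentiable_const _
  · intro z
    exact differentiableAt_id.const_cpow (Or.inl (by exact_mod_cast h))

lemma maskedCpow_rpow {x q y : ℝ} (hx : 0 ≤ x) (hq : 0 < q) :
    maskedCpow (x ^ q) y = if x = 0 then 0 else ((x ^ (q * y) : ℝ) : ℂ) := by
  unfold maskedCpow
  simp only [Real.rpow_eq_zero hx hq.ne']
  split_ifs
  · rfl
  · rw [← Complex.ofReal_cpow (Real.rpow_nonneg hx _), Real.rpow_mul hx]

lemma norm_diagonal_maskedCpow_le {f : n → ℝ} (hf : ∀ i, 0 ≤ f i) {z : ℂ}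
    (h0 : 0 ≤ z.re) (h1 : z.re ≤ 1) :
    ‖(diagonal fun i => maskedCpow (f i) z : Matrix n n ℂ)‖ ≤ 1 + ∑ i, f i := by
  rw [l2_opNorm_diagonal]
  have := Finset.sum_nonneg fun i (_ : i ∈ Finset.univ) => hf i
  refine (pi_norm_le_iff_of_nonneg (by linarith)).2 fun i => ?_
  have := Finset.single_le_sum (fun i _ => hf i) (Finset.mem_univ i)
  linarith [norm_maskedCpow_le (hf i) h0 h1]

lemma norm_diagonal_maskedCpow_le_one {f : n → ℝ} (hf : ∀ i, 0 ≤ f i) {z : ℂ} (hz : z.re = 0) :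
    ‖(diagonal fun i => maskedCpow (f i) z : Matrix n n ℂ)‖ ≤ 1 := by
  rw [l2_opNorm_diagonal]
  exact (pi_norm_le_iff_of_nonneg zero_le_one).2 fun i => norm_maskedCpow_le_one (hf i) hz

omit [Fintype m] [Fintype p] [DecidableEq m] [DecidableEq n] [DecidableEq p] in
lemma differentiable_matrix_mul_apply {F : ℂ → Matrix m n ℂ} {G : ℂ → Matrix n p ℂ}
    (hF : ∀ i j, Differentiable ℂ fun z => F z i j) (hG : ∀ i j, Differentiable ℂ fun z => G z i j)
    (i : m) (j : p) : Differentiable ℂ fun z => (F z * G z) i j := by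
  simp only [Matrix.mul_apply]
  exact Differentiable.fun_sum fun k _ => (hF i k).mul (hG k j)

omit [Fintype n] in
lemma differentiable_diagonal_maskedCpow_apply (f : n → ℝ) {w : ℂ → ℂ} (hw : Differentiable ℂ w)
    (i j : n) : Differentiable ℂ fun z => (diagonal fun i => maskedCpow (f i) (w z)) i j := by
  simp only [diagonal_apply]
  split_ifs
  · exact (differentiable_maskedCpow _).comp hw
  · exact differentiable_const _

lemma norm_trace_diagonal_mul_le (f : n → ℂ) (Y : Matrix n n ℂ) :
    ‖trace (diagonal f * Y)‖ ≤ (∑ i, ‖f i‖) * ‖Y‖ := by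
  simp only [trace, diag_apply, diagonal_mul, Finset.sum_mul]
  refine (norm_sum_le _ _).trans (Finset.sum_le_sum fun i _ => ?_)
  rw [norm_mul]
  gcongr
  exact norm_apply_le_l2_opNorm Y i i

/-- If the Hilbert–Schmidt norms of `P` and `R`, weighted by `|t|`, are at most `√c`, then
the trace of `diagonal f * P * diagonal t * R` is at most `c` for `f` bounded by one. -/
lemma norm_trace_le_of_weighted_sum_le {f : n → ℂ} (hf : ∀ i, ‖f i‖ ≤ 1) (P : Matrix n r ℂ)
    (t : r → ℂ) (R : Matrix r n ℂ) {c : ℝ} (hP : ∑ j, ‖t j‖ * ∑ i, ‖P i j‖ ^ 2 ≤ c)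
    (hR : ∑ j, ‖t j‖ * ∑ i, ‖R j i‖ ^ 2 ≤ c) :
    ‖trace (diagonal f * (P * (diagonal t * R)))‖ ≤ c := by
  have hentry (i : n) : (P * (diagonal t * R)) i i = ∑ j, P i j * (t j * R j i) := by
    rw [Matrix.mul_apply]
    simp only [diagonal_mul]
  simp only [trace, diag_apply, diagonal_mul, hentry]
  calc ‖∑ i, f i * ∑ j, P i j * (t j * R j i)‖
      ≤ ∑ i, ∑ j, ‖t j‖ * ((‖P i j‖ ^ 2 + ‖R j i‖ ^ 2) / 2) := by
        refine (norm_sum_le _ _).trans (Finset.sum_le_sum fun i _ => ?_)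
        rw [norm_mul]
        refine (mul_le_of_le_one_left (norm_nonneg _) (hf i)).trans ?_
        refine (norm_sum_le _ _).trans (Finset.sum_le_sum fun j _ => ?_)
        rw [norm_mul, norm_mul, mul_left_comm]
        gcongr
        nlinarith [sq_nonneg (‖P i j‖ - ‖R j i‖)]
    _ = (∑ j, ‖t j‖ * ∑ i, ‖P i j‖ ^ 2 + ∑ j, ‖t j‖ * ∑ i, ‖R j i‖ ^ 2) / 2 := by
        rw [Finset.sum_comm, ← Finset.sum_add_distrib, Finset.sum_div]
        refine Finset.sum_congr rfl fun j _ => ?_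
        rw [← mul_add, ← Finset.sum_add_distrib, mul_div_assoc, Finset.sum_div, Finset.mul_sum]
    _ ≤ c := by linarith

omit [DecidableEq m] in
lemma l2_opNorm_mul_le_of_le {M : Matrix m n ℂ} {N : Matrix n p ℂ} {a b : ℝ} (hM : ‖M‖ ≤ a)
    (hN : ‖N‖ ≤ b) : ‖M * N‖ ≤ a * b :=
  (l2_opNorm_mul M N).trans (mul_le_mul hM hN (norm_nonneg _) ((norm_nonneg _).trans hM))

/-- Three lines estimate for a trace of diagonal powers interlaced with contractions. -/
lemma norm_trace_interpolation {s : n → ℝ} {u : p → ℝ} {t : r → ℝ} (hs : ∀ i, 0 ≤ s i)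
    (hu : ∀ i, 0 ≤ u i) (ht : ∀ i, 0 ≤ t i) {K₁ : Matrix n p ℂ} {K₂ : Matrix p r ℂ}
    {K₃ : Matrix r p ℂ} {K₄ : Matrix p n ℂ} (h₁ : ‖K₁‖ ≤ 1) (h₂ : ‖K₂‖ ≤ 1) (h₃ : ‖K₃‖ ≤ 1)
    (h₄ : ‖K₄‖ ≤ 1) {c : ℝ} (hc₂ : ∑ j, t j * ∑ i, (u i * ‖K₂ i j‖) ^ 2 ≤ c)
    (hc₃ : ∑ j, t j * ∑ i, (‖K₃ j i‖ * u i) ^ 2 ≤ c) {θ : ℝ} (hθ : 0 ≤ θ) (hθ' : θ ≤ 1) :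
    ‖trace ((diagonal fun i => maskedCpow (s i) (1 - θ)) *
      ((K₁ * ((diagonal fun i => maskedCpow (u i) θ) * K₂)) *
        ((diagonal fun i => maskedCpow (t i) θ) *
          ((K₃ * diagonal fun i => maskedCpow (u i) θ) * K₄))))‖ ≤
      (∑ i, s i) ^ (1 - θ) * c ^ θ := by
  set Y : ℂ → Matrix n n ℂ := fun z => ((K₁ * ((diagonal fun i => maskedCpow (u i) z) * K₂)) *
        ((diagonal fun i => maskedCpow (t i) z) *
          ((K₃ * diagonal fun i => maskedCpow (u i) z) * K₄))) with hY
  set F : ℂ → ℂ := fun z => trace ((diagonal fun i => maskedCpow (s i) (1 - z)) * Y z) with hF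
  have hYle {z : ℂ} {a b : ℝ} (ha : ‖(diagonal fun i => maskedCpow (u i) z : Matrix p p ℂ)‖ ≤ a)
      (hb : ‖(diagonal fun i => maskedCpow (t i) z : Matrix r r ℂ)‖ ≤ b) :
      ‖Y z‖ ≤ (1 * (a * 1)) * (b * ((1 * a) * 1)) :=
    l2_opNorm_mul_le_of_le (l2_opNorm_mul_le_of_le h₁ (l2_opNorm_mul_le_of_le ha h₂))
      (l2_opNorm_mul_le_of_le hb (l2_opNorm_mul_le_of_le (l2_opNorm_mul_le_of_le h₃ ha) h₄))
  have hdiff : Differentiable ℂ F := by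
    have hd := differentiable_diagonal_maskedCpow_apply u differentiable_fun_id
    have ht' := differentiable_diagonal_maskedCpow_apply t differentiable_fun_id
    have hs' := differentiable_diagonal_maskedCpow_apply s
      ((differentiable_const (1 : ℂ)).fun_sub differentiable_fun_id)
    have hl := differentiable_matrix_mul_apply (F := fun _ => K₁)
      (fun i j => differentiable_const _)
      (differentiable_matrix_mul_apply hd (G := fun _ => K₂) fun i j => differentiable_const _)
    have hr := differentiable_matrix_mul_apply ht'
      (differentiable_matrix_mul_apply
        (differentiable_matrix_mul_apply (F := fun _ => K₃) (fun i j => differentiable_const _) hd)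
        (G := fun _ => K₄) fun i j => differentiable_const _)
    have hall := differentiable_matrix_mul_apply hs' (differentiable_matrix_mul_apply hl hr)
    exact Differentiable.fun_sum fun i _ => hall i i
  have hbdd : BddAbove ((norm ∘ F) '' Complex.HadamardThreeLines.verticalClosedStrip 0 1) := by
    refine ⟨(∑ i, (1 + s i)) * ((1 * ((1 + ∑ i, u i) * 1)) *
      ((1 + ∑ i, t i) * ((1 * (1 + ∑ i, u i)) * 1))), ?_⟩
    rintro _ ⟨z, ⟨hz0, hz1⟩, rfl⟩
    refine (norm_trace_diagonal_mul_le _ _).trans ?_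
    refine mul_le_mul (Finset.sum_le_sum fun i _ => ?_)
      (hYle (norm_diagonal_maskedCpow_le hu hz0 hz1) (norm_diagonal_maskedCpow_le ht hz0 hz1))
      (norm_nonneg _) (Finset.sum_nonneg fun i _ => by linarith [hs i])
    refine norm_maskedCpow_le (hs i) ?_ ?_ <;> simp <;> assumption
  have hleft : ∀ z ∈ Complex.re ⁻¹' {(0 : ℝ)}, ‖F z‖ ≤ ∑ i, s i := by
    intro z hz
    replace hz : z.re = 0 := hz
    refine (norm_trace_diagonal_mul_le _ _).trans ?_
    rw [← mul_one (∑ i, s i)]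
    refine mul_le_mul (Finset.sum_le_sum fun i _ => ?_) ?_ (norm_nonneg _)
      (Finset.sum_nonneg fun i _ => hs i)
    · exact (norm_maskedCpow_of_re_eq_one (hs i) (by simp [hz])).le
    · simpa using hYle (norm_diagonal_maskedCpow_le_one hu hz)
        (norm_diagonal_maskedCpow_le_one ht hz)
  have hright : ∀ z ∈ Complex.re ⁻¹' {(1 : ℝ)}, ‖F z‖ ≤ c := by
    intro z hz
    replace hz : z.re = 1 := hz
    refine norm_trace_le_of_weighted_sum_le
      (fun i => norm_maskedCpow_le_one (hs i) (by simp [hz])) _ _ _ ?_ ?_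
    · refine le_trans (Finset.sum_le_sum fun j _ => ?_) hc₂
      rw [norm_maskedCpow_of_re_eq_one (ht j) hz]
      refine mul_le_mul_of_nonneg_left ((sum_norm_sq_mul_col_le _ _ j).trans ?_) (ht j)
      refine (mul_le_of_le_one_left (by positivity) (pow_le_one₀ (norm_nonneg _) h₁)).trans ?_
      simp [norm_maskedCpow_of_re_eq_one (hu _) hz]
    · refine le_trans (Finset.sum_le_sum fun j _ => ?_) hc₃
      rw [norm_maskedCpow_of_re_eq_one (ht j) hz]
      refine mul_le_mul_of_nonneg_left ((sum_norm_sq_mul_row_le _ _ j).trans ?_) (ht j)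
      refine (mul_le_of_le_one_left (by positivity) (pow_le_one₀ (norm_nonneg _) h₄)).trans ?_
      simp [norm_maskedCpow_of_re_eq_one (hu _) hz]
  have := Complex.HadamardThreeLines.norm_le_interp_of_mem_verticalClosedStrip' (z := (θ : ℂ))
    zero_lt_one ⟨by simpa using hθ, by simpa using hθ'⟩ hdiff.diffContOnCl hbdd hleft hright
  simpa using this

lemma sum_eigenvalues_eq_of_eq_conj_diagonal {M : Matrix n n ℂ} (hM : M.IsHermitian)
    {V : Matrix n n ℂ} (hV : Vᴴ * V = 1) {f : n → ℝ}
    (h : M = V * diagonal (fun i => (f i : ℂ)) * Vᴴ) (g : ℝ → ℝ) :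
    ∑ i, g (hM.eigenvalues i) = ∑ i, g (f i) := by
  have hchar : M.charpoly = (diagonal fun i => (f i : ℂ)).charpoly := by
    rw [h, charpoly_mul_comm, ← Matrix.mul_assoc, hV, Matrix.one_mul]
  have hroots := hM.roots_charpoly_eq_eigenvalues
  rw [hchar, charpoly_diagonal, Polynomial.roots_prod _ _
    (Finset.prod_ne_zero_iff.2 fun i _ => Polynomial.X_sub_C_ne_zero _)] at hroots
  simp only [Polynomial.roots_X_sub_C, Multiset.bind_singleton] at hroots
  have h2 := congrArg (fun s => (Multiset.map (fun z : ℂ => g z.re) s).sum) hroots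
  simp only [Multiset.map_map] at h2
  exact h2.symm

omit [DecidableEq m] in
lemma schattenNorm_conjTranspose_mul_self_rpow {q : ℝ} (hq : 0 < q) (X : Matrix m n ℂ) :
    schattenNorm q (Xᴴ * X) ^ q = ∑ i, (singularValue X i ^ q) ^ 2 := by
  obtain ⟨U, V, hV, -, hX, hU⟩ := exists_singularValue_decomposition X
  set D : Matrix n n ℂ := diagonal fun i => (singularValue X i : ℂ) with hD
  have hDD : Dᴴ = D := by
    rw [hD, diagonal_conjTranspose]
    congr 1
    ext i
    simp
  have hXX : Xᴴ * X = V * (D * D) * Vᴴ := by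
    have hUD : Uᴴ * U * D = D := by
      rw [hU, hD, diagonal_mul_diagonal]
      congr 1
      ext i
      split_ifs with h <;> simp [h]
    calc Xᴴ * X = V * D * (Uᴴ * U * D) * Vᴴ := by
          conv_lhs => rw [hX]
          simp only [conjTranspose_mul, conjTranspose_conjTranspose, hDD, Matrix.mul_assoc]
      _ = _ := by rw [hUD, Matrix.mul_assoc V]
  have hXX4 : (Xᴴ * X)ᴴ * (Xᴴ * X) =
      V * diagonal (fun i => ((singularValue X i ^ 4 : ℝ) : ℂ)) * Vᴴ := by
    calc (Xᴴ * X)ᴴ * (Xᴴ * X) = V * (D * D) * (Vᴴ * V) * (D * D) * Vᴴ := by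
          rw [hXX]
          simp only [conjTranspose_mul, conjTranspose_conjTranspose, hDD, Matrix.mul_assoc]
      _ = V * (D * D * (D * D)) * Vᴴ := by
          rw [hV, Matrix.mul_one, Matrix.mul_assoc V]
      _ = _ := by
          simp only [hD, diagonal_mul_diagonal]
          congr 3
          ext i
          push_cast
          ring
  rw [schattenNorm, one_div, Real.rpow_inv_rpow _ hq.ne',
    sum_eigenvalues_eq_of_eq_conj_diagonal _ hV hXX4 fun x => x ^ (q / 2)]
  · refine Finset.sum_congr rfl fun i _ => ?_
    have h0 := singularValue_nonneg X i
    rw [← Real.rpow_natCast, ← Real.rpow_natCast, ← Real.rpow_mul h0, ← Real.rpow_mul h0]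
    congr 1
    push_cast
    ring
  · exact Finset.sum_nonneg fun i _ => Real.rpow_nonneg
      ((posSemidef_conjTranspose_mul_self _).eigenvalues_nonneg i) _

/-- The block diagonal matrix with blocks `M x`, the block index being the first coordinate. -/
def kroneckerBlockDiagonal {R : Type*} [DecidableEq R] (M : R → Matrix m n ℂ) :
    Matrix (R × m) (R × n) ℂ :=
  of fun x y => if x.1 = y.1 then M x.1 x.2 y.2 else 0

section BlockDiagonal

variable {R : Type*} [Fintype R] [DecidableEq R]

omit [Fintype m] [Fintype p] [DecidableEq m] [DecidableEq n] [DecidableEq p] in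
lemma kroneckerBlockDiagonal_mul (M : R → Matrix m n ℂ) (N : R → Matrix n p ℂ) :
    kroneckerBlockDiagonal M * kroneckerBlockDiagonal N =
      kroneckerBlockDiagonal fun x => M x * N x := by
  ext ⟨x, i⟩ ⟨y, j⟩
  simp [kroneckerBlockDiagonal, Matrix.mul_apply, Fintype.sum_prod_type]
  split_ifs with h
  · rw [h]
  · rfl

omit [Fintype m] [Fintype n] [DecidableEq m] [DecidableEq n] [Fintype R] in
lemma kroneckerBlockDiagonal_conjTranspose (M : R → Matrix m n ℂ) :
    (kroneckerBlockDiagonal M)ᴴ = kroneckerBlockDiagonal fun x => (M x)ᴴ := by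
  ext ⟨x, i⟩ ⟨y, j⟩
  by_cases h : x = y
  · subst h
    simp [kroneckerBlockDiagonal]
  · simp [kroneckerBlockDiagonal, h, Ne.symm h]

omit [Fintype n] [Fintype R] in
lemma kroneckerBlockDiagonal_diagonal (f : R → n → ℂ) :
    kroneckerBlockDiagonal (fun x => diagonal (f x)) = diagonal fun x => f x.1 x.2 := by
  ext ⟨x, i⟩ ⟨y, j⟩
  by_cases h : x = y <;> by_cases h' : i = j <;>
    simp [kroneckerBlockDiagonal, diagonal_apply, h, h']

omit [DecidableEq m] in
lemma norm_kroneckerBlockDiagonal_le_one {M : R → Matrix m n ℂ} {f : R → n → ℂ}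
    (h : ∀ x, (M x)ᴴ * M x = diagonal (f x)) (hf : ∀ x i, ‖f x i‖ ≤ 1) :
    ‖kroneckerBlockDiagonal M‖ ≤ 1 := by
  refine norm_le_one_of_conjTranspose_mul_self (f := fun x => f x.1 x.2) ?_ fun x => hf _ _
  rw [kroneckerBlockDiagonal_conjTranspose, kroneckerBlockDiagonal_mul]
  simp only [h, kroneckerBlockDiagonal_diagonal]

omit [DecidableEq m] in
lemma norm_kronecker_one_le_one {M : Matrix m n ℂ} {f : n → ℂ}
    (h : Mᴴ * M = diagonal f) (hf : ∀ i, ‖f i‖ ≤ 1) :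
    ‖M ⊗ₖ (1 : Matrix p p ℂ)‖ ≤ 1 := by
  refine norm_le_one_of_conjTranspose_mul_self (f := fun x => f x.1 * 1) ?_ fun x => ?_
  · rw [conjTranspose_kronecker, ← mul_kronecker_mul, h, conjTranspose_one, Matrix.one_mul,
      ← diagonal_one, diagonal_kronecker_diagonal]
  · simpa using hf _

omit [Fintype l] [Fintype m] [DecidableEq l] [DecidableEq m] in
lemma kroneckerBlockDiagonal_mul_kronecker_one_apply (M : R → Matrix m n ℂ) (N : Matrix R l ℂ)
    (x : R × m) (y : l × n) :
    (kroneckerBlockDiagonal M * N ⊗ₖ (1 : Matrix n n ℂ)) x y = N x.1 y.1 * M x.1 x.2 y.2 := by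
  simp [kroneckerBlockDiagonal, Matrix.mul_apply, Fintype.sum_prod_type, Matrix.one_apply]
  ring

omit [Fintype l] [Fintype n] [DecidableEq l] [DecidableEq n] in
lemma kronecker_one_mul_kroneckerBlockDiagonal_apply (M : R → Matrix m n ℂ) (N : Matrix l R ℂ)
    (x : l × m) (y : R × n) :
    (N ⊗ₖ (1 : Matrix m m ℂ) * kroneckerBlockDiagonal M) x y = N x.1 y.1 * M y.1 x.2 y.2 := by
  simp [kroneckerBlockDiagonal, Matrix.mul_apply, Fintype.sum_prod_type, Matrix.one_apply]

omit [DecidableEq l] [DecidableEq m] [DecidableEq R] in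
lemma weighted_sum_sq_le {t : R → m → ℝ} (ht : ∀ x j, 0 ≤ t x j) {β : ℝ}
    (hβ : ∀ x, ∑ j, t x j ≤ β) (hβ0 : 0 ≤ β) {a : R → m → m → ℝ} (ha : ∀ x j, ∑ i, a x i j ^ 2 ≤ 1)
    {w : R → l → ℝ} (hw : ∀ b, ∑ x, w x b ^ 2 ≤ 1) (u : l → ℝ) :
    ∑ y : R × m, t y.1 y.2 * ∑ x : l × m, (w y.1 x.1 * a y.1 x.2 y.2 * u x.1) ^ 2 ≤
      β * ∑ b, u b ^ 2 := by
  calc ∑ y : R × m, t y.1 y.2 * ∑ x : l × m, (w y.1 x.1 * a y.1 x.2 y.2 * u x.1) ^ 2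
      = ∑ x, (∑ j, t x j * ∑ i, a x i j ^ 2) * ∑ b, w x b ^ 2 * u b ^ 2 := by
        rw [Fintype.sum_prod_type]
        refine Finset.sum_congr rfl fun x _ => ?_
        rw [Finset.sum_mul]
        refine Finset.sum_congr rfl fun j _ => ?_
        rw [mul_assoc, Fintype.sum_prod_type, mul_comm (∑ i, a x i j ^ 2), Finset.sum_mul_sum]
        congr 1
        refine Finset.sum_congr rfl fun b _ => Finset.sum_congr rfl fun i _ => ?_
        ring
    _ ≤ ∑ x, β * ∑ b, w x b ^ 2 * u b ^ 2 := by
        refine Finset.sum_le_sum fun x _ => mul_le_mul_of_nonneg_right ?_ (by positivity)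
        refine (Finset.sum_le_sum fun j _ => ?_).trans (hβ x)
        exact mul_le_of_le_one_right (ht x j) (ha x j)
    _ = β * ∑ b, (∑ x, w x b ^ 2) * u b ^ 2 := by
        rw [← Finset.mul_sum, Finset.sum_comm]
        simp only [Finset.sum_mul]
    _ ≤ β * ∑ b, u b ^ 2 := by
        refine mul_le_mul_of_nonneg_left (Finset.sum_le_sum fun b _ => ?_) hβ0
        exact mul_le_of_le_one_left (sq_nonneg _) (hw b)

omit [DecidableEq m] in
lemma sum_norm_sq_col_le_one {C : Matrix m n ℂ} (hC : ‖C‖ ≤ 1) (j : n) :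
    ∑ i, ‖C i j‖ ^ 2 ≤ 1 :=
  (sum_norm_sq_col_le C j).trans (pow_le_one₀ (norm_nonneg _) hC)

open scoped MatrixOrder in
lemma exists_eq_conjTranspose_mul_self {M : Matrix n n ℂ} (hM : M.PosSemidef) :
    ∃ C : Matrix n n ℂ, M = Cᴴ * C :=
  CStarAlgebra.nonneg_iff_eq_star_mul_self.mp hM.nonneg

lemma norm_maskedOne_le (x : ℝ) : ‖(if x = 0 then 0 else 1 : ℂ)‖ ≤ 1 := by
  split_ifs <;> simp

/-- The Schatten norm bound for a block diagonal matrix compressed by `X ⊗ₖ 1`. -/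
lemma schattenNorm_compression_le {q : ℝ} (hq : 1 ≤ q) (X : Matrix R l ℂ) (B : R → Matrix m m ℂ)
    {b : ℝ} (hb0 : 0 ≤ b) (hb : ∀ x, schattenNorm q (B x) ≤ b) :
    schattenNorm q ((Xᴴ ⊗ₖ (1 : Matrix m m ℂ)) * kroneckerBlockDiagonal B *
      (X ⊗ₖ (1 : Matrix m m ℂ))) ≤ schattenNorm q (Xᴴ * X) * b := by
  have hq0 : 0 < q := zero_lt_one.trans_le hq
  set M := (Xᴴ ⊗ₖ (1 : Matrix m m ℂ)) * kroneckerBlockDiagonal B *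
      (X ⊗ₖ (1 : Matrix m m ℂ)) with hM
  obtain ⟨UM, VM, hVM, hVM', hMsvd, hUM⟩ := exists_singularValue_decomposition M
  obtain ⟨U, Q, hQ, hQ', hX, hU⟩ := exists_singularValue_decomposition X
  choose W V hV hV' hB hW using fun x => exists_singularValue_decomposition (B x)
  set Λ : Matrix (l × m) (l × m) ℂ := diagonal fun x => (singularValue X x.1 : ℂ) with hΛ
  set T : Matrix (R × m) (R × m) ℂ := diagonal fun x => (singularValue (B x.1) x.2 : ℂ) with hT
  set K₁ := UMᴴ * (Q ⊗ₖ (1 : Matrix m m ℂ)) with hK₁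
  set K₂ := (Uᴴ ⊗ₖ (1 : Matrix m m ℂ)) * kroneckerBlockDiagonal W with hK₂
  set K₃ := (kroneckerBlockDiagonal fun x => (V x)ᴴ) * (U ⊗ₖ (1 : Matrix m m ℂ)) with hK₃
  set K₄ := (Qᴴ ⊗ₖ (1 : Matrix m m ℂ)) * VM with hK₄
  have hΛ' : Λ = diagonal (fun i => (singularValue X i : ℂ)) ⊗ₖ (1 : Matrix m m ℂ) := by
    rw [← diagonal_one, diagonal_kronecker_diagonal]
    simp [hΛ]
  have hDB : kroneckerBlockDiagonal B = kroneckerBlockDiagonal W * T *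
      kroneckerBlockDiagonal fun x => (V x)ᴴ := by
    rw [hT, ← kroneckerBlockDiagonal_diagonal
      (f := fun x i => (singularValue (B x) i : ℂ)), kroneckerBlockDiagonal_mul,
      kroneckerBlockDiagonal_mul]
    congr 1
    ext1 x
    exact hB x
  have hXk : X ⊗ₖ (1 : Matrix m m ℂ) =
      (U ⊗ₖ (1 : Matrix m m ℂ)) * Λ * (Qᴴ ⊗ₖ (1 : Matrix m m ℂ)) := by
    rw [hΛ', ← mul_kronecker_mul, ← mul_kronecker_mul, Matrix.one_mul, Matrix.one_mul, ← hX]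
  have hΛH : Λᴴ = Λ := by
    rw [hΛ, diagonal_conjTranspose]
    congr 1
    ext i
    simp
  have hXk' : Xᴴ ⊗ₖ (1 : Matrix m m ℂ) =
      (Q ⊗ₖ (1 : Matrix m m ℂ)) * Λ * (Uᴴ ⊗ₖ (1 : Matrix m m ℂ)) := by
    have := congrArg conjTranspose hXk
    simpa only [conjTranspose_mul, conjTranspose_kronecker, conjTranspose_one, hΛH,
      conjTranspose_conjTranspose, Matrix.mul_assoc] using this
  have hcompr : K₁ * (Λ * K₂) * (T * (K₃ * Λ * K₄)) =
      diagonal fun i => (singularValue M i : ℂ) := by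
    calc K₁ * (Λ * K₂) * (T * (K₃ * Λ * K₄)) = UMᴴ * M * VM := by
          rw [hM, hDB, hXk, hXk']
          simp only [hK₁, hK₂, hK₃, hK₄, Matrix.mul_assoc]
      _ = UMᴴ * UM * (diagonal fun i => (singularValue M i : ℂ)) * (VMᴴ * VM) := by
          conv_lhs => rw [hMsvd]
          simp only [Matrix.mul_assoc]
      _ = _ := by
          rw [hVM, Matrix.mul_one, hUM, diagonal_mul_diagonal]
          congr 1
          ext i
          split_ifs with h <;> simp [h]
  have nQ : ‖Q ⊗ₖ (1 : Matrix m m ℂ)‖ ≤ 1 :=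
    norm_kronecker_one_le_one (hQ.trans diagonal_one.symm) (by simp)
  have nQ' : ‖Qᴴ ⊗ₖ (1 : Matrix m m ℂ)‖ ≤ 1 :=
    norm_kronecker_one_le_one
      (by rw [conjTranspose_conjTranspose]; exact hQ'.trans diagonal_one.symm) (by simp)
  have nU : ‖U ⊗ₖ (1 : Matrix m m ℂ)‖ ≤ 1 :=
    norm_kronecker_one_le_one hU fun i => norm_maskedOne_le _
  have nU' : ‖Uᴴ ⊗ₖ (1 : Matrix m m ℂ)‖ ≤ 1 := by
    rw [← l2_opNorm_conjTranspose, conjTranspose_kronecker, conjTranspose_conjTranspose,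
      conjTranspose_one]
    exact nU
  have nU0 : ‖U‖ ≤ 1 := norm_le_one_of_conjTranspose_mul_self hU fun i => norm_maskedOne_le _
  have nUM : ‖UMᴴ‖ ≤ 1 := by
    rw [l2_opNorm_conjTranspose]
    exact norm_le_one_of_conjTranspose_mul_self hUM fun i => norm_maskedOne_le _
  have nVM : ‖VM‖ ≤ 1 := norm_le_one_of_conjTranspose_mul_self (hVM.trans diagonal_one.symm)
    (by simp)
  have nW : ‖kroneckerBlockDiagonal W‖ ≤ 1 :=
    norm_kroneckerBlockDiagonal_le_one hW fun x i => norm_maskedOne_le _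
  have nV : ‖kroneckerBlockDiagonal fun x => (V x)ᴴ‖ ≤ 1 :=
    norm_kroneckerBlockDiagonal_le_one (f := fun _ _ => 1)
      (fun x => by simpa only [conjTranspose_conjTranspose] using (hV' x).trans diagonal_one.symm)
      (by simp)
  have n1 : ‖K₁‖ ≤ 1 := by simpa using l2_opNorm_mul_le_of_le nUM nQ
  have n2 : ‖K₂‖ ≤ 1 := by simpa using l2_opNorm_mul_le_of_le nU' nW
  have n3 : ‖K₃‖ ≤ 1 := by simpa using l2_opNorm_mul_le_of_le nV nU
  have n4 : ‖K₄‖ ≤ 1 := by simpa using l2_opNorm_mul_le_of_le nQ' nVM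
  have hpow (x : ℝ) (hx : 0 ≤ x) : maskedCpow (x ^ q) ((1 / q : ℝ) : ℂ) = x := by
    rw [maskedCpow_rpow hx hq0, mul_one_div_cancel hq0.ne', Real.rpow_one]
    split_ifs with h <;> simp [h]
  have ht (x : R) (j : m) : 0 ≤ singularValue (B x) j ^ q :=
    Real.rpow_nonneg (singularValue_nonneg _ _) _
  have hβ (x : R) : ∑ j, singularValue (B x) j ^ q ≤ b ^ q := by
    rw [← schattenNorm_rpow hq0]
    exact Real.rpow_le_rpow (schattenNorm_nonneg _ _) (hb x) hq0.le
  have hmain := norm_trace_interpolation (s := fun i => singularValue M i ^ q)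
    (u := fun x : l × m => singularValue X x.1 ^ q)
    (t := fun x : R × m => singularValue (B x.1) x.2 ^ q)
    (fun i => Real.rpow_nonneg (singularValue_nonneg _ _) _)
    (fun i => Real.rpow_nonneg (singularValue_nonneg _ _) _)
    (fun i => ht _ _) n1 n2 n3 n4 (c := b ^ q * ∑ i, (singularValue X i ^ q) ^ 2)
    (by
      refine le_trans (le_of_eq ?_) (weighted_sum_sq_le ht hβ (Real.rpow_nonneg hb0 _)
        (a := fun x i j => ‖W x i j‖) (w := fun x i => ‖U x i‖)
        (fun x j => sum_norm_sq_col_le_one (norm_le_one_of_conjTranspose_mul_self (hW x)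
          fun i => norm_maskedOne_le _) j) (sum_norm_sq_col_le_one nU0) _)
      refine Finset.sum_congr rfl fun y _ => ?_
      congr 1
      refine Finset.sum_congr rfl fun x _ => ?_
      rw [hK₂, kronecker_one_mul_kroneckerBlockDiagonal_apply, norm_mul, conjTranspose_apply,
        norm_star]
      ring)
    (by
      refine le_trans (le_of_eq ?_) (weighted_sum_sq_le ht hβ (Real.rpow_nonneg hb0 _)
        (a := fun x i j => ‖V x i j‖) (w := fun x i => ‖U x i‖)
        (fun x j => sum_norm_sq_col_le_one (norm_le_one_of_conjTranspose_mul_self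
          ((hV x).trans diagonal_one.symm) (by simp)) j) (sum_norm_sq_col_le_one nU0) _)
      refine Finset.sum_congr rfl fun y _ => ?_
      congr 1
      refine Finset.sum_congr rfl fun x _ => ?_
      rw [hK₃, kroneckerBlockDiagonal_mul_kronecker_one_apply, norm_mul, conjTranspose_apply,
        norm_star])
    (θ := 1 / q) (by positivity) ((div_le_one hq0).2 hq)
  simp only [hpow _ (singularValue_nonneg _ _)] at hmain
  rw [← hΛ, ← hT, hcompr, diagonal_mul_diagonal, trace_diagonal] at hmain
  have htr : ∑ i, maskedCpow (singularValue M i ^ q) (1 - ((1 / q : ℝ) : ℂ)) * singularValue M i =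
      ((∑ i, singularValue M i ^ q : ℝ) : ℂ) := by
    rw [Complex.ofReal_sum]
    refine Finset.sum_congr rfl fun i _ => ?_
    have h0 := singularValue_nonneg M i
    rw [show (1 : ℂ) - ((1 / q : ℝ) : ℂ) = ((1 - 1 / q : ℝ) : ℂ) by push_cast; ring,
      maskedCpow_rpow h0 hq0]
    split_ifs with h
    · rw [h, Real.zero_rpow hq0.ne']
      simp
    · rw [← Complex.ofReal_mul, ← Real.rpow_add_one h]
      congr 2
      field_simp
      ring
  rw [htr, Complex.norm_real, ← schattenNorm_rpow hq0,
    ← schattenNorm_conjTranspose_mul_self_rpow hq0, Real.norm_of_nonneg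
      (Real.rpow_nonneg (schattenNorm_nonneg _ _) _),
    ← Real.mul_rpow hb0 (schattenNorm_nonneg _ _), one_div,
    Real.rpow_rpow_inv (mul_nonneg hb0 (schattenNorm_nonneg _ _)) hq0.ne'] at hmain
  rcases (schattenNorm_nonneg q M).eq_or_lt with h | h
  · rw [← h]
    exact mul_nonneg (schattenNorm_nonneg _ _) hb0
  · rw [← Real.rpow_mul h.le, mul_sub, mul_inv_cancel₀ hq0.ne', mul_one, Real.rpow_sub_one h.ne',
      div_mul_eq_mul_div, le_div_iff₀ h] at hmain
    rw [mul_comm _ b]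
    exact le_of_mul_le_mul_left hmain (Real.rpow_pos_of_pos h q)

omit [Fintype l] [DecidableEq l] in
lemma compression_eq_sum (X : Matrix R l ℂ) (B : R → Matrix m m ℂ) :
    (Xᴴ ⊗ₖ (1 : Matrix m m ℂ)) * kroneckerBlockDiagonal B * (X ⊗ₖ (1 : Matrix m m ℂ)) =
      of fun i j => ∑ x, star (X x i.1) * X x j.1 * B x i.2 j.2 := by
  ext i j
  rw [Matrix.mul_assoc, Matrix.mul_apply]
  simp only [kroneckerBlockDiagonal_mul_kronecker_one_apply]
  simp [Fintype.sum_prod_type, Matrix.one_apply, mul_assoc]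

end BlockDiagonal

end SchattenAux

/-- For PSD matrices `A k` and arbitrary matrices `B k`, and `q ≥ 1`,
`‖Σ_k A_k ⊗ B_k‖_q ≤ ‖Σ_k A_k‖_q · max_j ‖B_j‖_q`. -/
theorem schatten_sum_kronecker_le (d m K : ℕ) (hK : 0 < K) (q : ℝ) (hq : 1 ≤ q)
    (A : Fin K → Matrix (Fin d) (Fin d) ℂ) (B : Fin K → Matrix (Fin m) (Fin m) ℂ)
    (hA : ∀ k, (A k).PosSemidef) :
    schattenNorm q (∑ k, A k ⊗ₖ B k) ≤
      schattenNorm q (∑ k, A k) * ⨆ j : Fin K, schattenNorm q (B j) := by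
  obtain ⟨k₀⟩ : Nonempty (Fin K) := ⟨⟨0, hK⟩⟩
  have hbdd : BddAbove (Set.range fun j : Fin K => schattenNorm q (B j)) :=
    (Set.finite_range _).bddAbove
  choose C hC using fun k => exists_eq_conjTranspose_mul_self (hA k)
  let X : Matrix (Fin K × Fin d) (Fin d) ℂ := of fun x j => C x.1 x.2 j
  have hX : ∑ k, A k = Xᴴ * X := by
    ext i j
    simp only [Matrix.sum_apply, hC, Matrix.mul_apply, Fintype.sum_prod_type, X,
      conjTranspose_apply, of_apply]
  have hM : ∑ k, A k ⊗ₖ B k =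
      of fun i j => ∑ x, star (X x i.1) * X x j.1 * B x.1 i.2 j.2 := by
    ext i j
    simp only [Matrix.sum_apply, kroneckerMap_apply, hC, Matrix.mul_apply, Fintype.sum_prod_type, X,
      conjTranspose_apply, of_apply, Finset.sum_mul]
  rw [hM, ← compression_eq_sum X fun x => B x.1, hX]
  exact schattenNorm_compression_le hq X _
    ((schattenNorm_nonneg q (B k₀)).trans (le_ciSup hbdd k₀)) fun x => le_ciSup hbdd x.1
end

section
/- Let A_1,…,A_K be positive semidefinite d×d complex matrices, let B_1,…,B_K be arbitrary m×m complex matrices, and let q ≥ 1. Then ‖Σ_{k=1}^K A_k ⊗ B_k‖_q ≤ ‖Σ_{k=1}^K ‖B_k‖_q · A_k‖_q, where on the right-hand side each scalar ‖B_k‖_q multiplies the matrix A_k. -/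
open scoped Kronecker ComplexOrder
open Matrix

section Interpolation

open scoped Matrix Matrix.Norms.L2Operator

/-- The power `x ^ z`, with the convention that every power of zero vanishes. -/
noncomputable def zeroCpow (x : ℝ) (z : ℂ) : ℂ := if x = 0 then 0 else (x : ℂ) ^ z

lemma differentiable_zeroCpow (x : ℝ) {g : ℂ → ℂ} (hg : Differentiable ℂ g) :
    Differentiable ℂ fun z => zeroCpow x (g z) := by
  unfold zeroCpow
  split_ifs with h
  · exact differentiable_const _
  · intro z
    exact (hg z).const_cpow (Or.inl (by exact_mod_cast h))

lemma norm_zeroCpow_le {x : ℝ} (hx : 0 ≤ x) (z : ℂ) : ‖zeroCpow x z‖ ≤ x ^ z.re := by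
  unfold zeroCpow
  split_ifs with h
  · simpa using Real.rpow_nonneg hx _
  · rw [Complex.norm_cpow_eq_rpow_re_of_pos (lt_of_le_of_ne hx (Ne.symm h))]

lemma norm_zeroCpow_le_one {x : ℝ} (hx : 0 ≤ x) {z : ℂ} (hz : z.re = 0) :
    ‖zeroCpow x z‖ ≤ 1 := by
  simpa [hz] using norm_zeroCpow_le hx z

lemma norm_zeroCpow_le_max {x r : ℝ} (hx : 0 ≤ x) {z : ℂ} (h₀ : 0 ≤ z.re) (h₁ : z.re ≤ r) :
    ‖zeroCpow x z‖ ≤ max 1 x ^ r :=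
  (norm_zeroCpow_le hx z).trans <|
    (Real.rpow_le_rpow hx (le_max_right 1 x) h₀).trans
      (Real.rpow_le_rpow_of_exponent_le (le_max_left 1 x) h₁)

lemma zeroCpow_ofReal {x : ℝ} (hx : 0 ≤ x) {r : ℝ} (hr : 0 < r) :
    zeroCpow x r = ((x ^ r : ℝ) : ℂ) := by
  unfold zeroCpow
  split_ifs with h
  · simp [h, Real.zero_rpow hr.ne']
  · rw [Complex.ofReal_cpow hx]

lemma zeroCpow_mul_self {x : ℝ} (hx : 0 ≤ x) {r : ℝ} (hr : 0 < r) :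
    zeroCpow x ((r - 1 : ℝ) : ℂ) * x = ((x ^ r : ℝ) : ℂ) := by
  unfold zeroCpow
  split_ifs with h
  · simp [h, Real.zero_rpow hr.ne']
  · rw [← Complex.ofReal_cpow hx, ← Complex.ofReal_mul, Real.rpow_sub_one h,
      div_mul_cancel₀ _ h]

lemma l2_opNorm_le_one_of_conjTranspose_mul_self_eq_diagonal {m n : Type*} [Fintype m]
    [Fintype n] [DecidableEq n] {M : Matrix m n ℂ} {v : n → ℂ} (h : Mᴴ * M = diagonal v)
    (hv : ∀ i, ‖v i‖ ≤ 1) : ‖M‖ ≤ 1 := by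
  have h₁ := Matrix.l2_opNorm_conjTranspose_mul_self M
  rw [h, Matrix.l2_opNorm_diagonal] at h₁
  have h₂ : ‖v‖ ≤ 1 := (pi_norm_le_iff_of_nonneg zero_le_one).2 hv
  nlinarith [norm_nonneg M]

lemma norm_dotProduct_mulVec_le {m n : Type*} [Fintype m] [Fintype n] [DecidableEq n]
    (M : Matrix m n ℂ) (y : m → ℂ) (x : n → ℂ) :
    ‖y ⬝ᵥ M *ᵥ x‖ ≤ ‖M‖ * ((∑ i, ‖y i‖ ^ 2 + ∑ j, ‖x j‖ ^ 2) / 2) := by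
  have h₁ : ‖WithLp.toLp 2 (M *ᵥ x)‖ ≤ ‖M‖ * ‖WithLp.toLp 2 x‖ :=
    Matrix.l2_opNorm_mulVec M (WithLp.toLp 2 x)
  have h₂ := norm_inner_le_norm (𝕜 := ℂ) (WithLp.toLp 2 (star y)) (WithLp.toLp 2 (M *ᵥ x))
  have h₃ : inner ℂ (WithLp.toLp 2 (star y)) (WithLp.toLp 2 (M *ᵥ x)) = y ⬝ᵥ M *ᵥ x := by
    rw [EuclideanSpace.inner_toLp_toLp, star_star, dotProduct_comm]
  rw [h₃] at h₂
  have h₄ : ‖WithLp.toLp 2 (star y)‖ ^ 2 = ∑ i, ‖y i‖ ^ 2 := by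
    simp [EuclideanSpace.norm_sq_eq]
  have h₅ : ‖WithLp.toLp 2 x‖ ^ 2 = ∑ i, ‖x i‖ ^ 2 := by
    simp [EuclideanSpace.norm_sq_eq]
  rw [← h₄, ← h₅]
  calc _ ≤ ‖WithLp.toLp 2 (star y)‖ * (‖M‖ * ‖WithLp.toLp 2 x‖) :=
        h₂.trans (mul_le_mul_of_nonneg_left h₁ (norm_nonneg _))
    _ = ‖M‖ * (‖WithLp.toLp 2 (star y)‖ * ‖WithLp.toLp 2 x‖) := by ring
    _ ≤ _ := by
      gcongr
      linarith [two_mul_le_add_sq ‖WithLp.toLp 2 (star y)‖ ‖WithLp.toLp 2 x‖]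

lemma norm_entry_le_l2_opNorm {n : Type*} [Fintype n] [DecidableEq n] (M : Matrix n n ℂ)
    (i j : n) : ‖M i j‖ ≤ ‖M‖ := by
  have h := norm_dotProduct_mulVec_le M (Pi.single i 1) (Pi.single j 1)
  have hs (k : n) : ∑ l, ‖(Pi.single k 1 : n → ℂ) l‖ ^ 2 = 1 := by
    rw [Finset.sum_eq_single k] <;> simp +contextual
  simpa [hs] using h

lemma differentiable_matrix_mul {l m n : Type*} [Fintype m] {f : ℂ → Matrix l m ℂ}
    {g : ℂ → Matrix m n ℂ} (hf : ∀ i j, Differentiable ℂ fun z => f z i j)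
    (hg : ∀ i j, Differentiable ℂ fun z => g z i j) (i : l) (j : n) :
    Differentiable ℂ fun z => (f z * g z) i j := by
  simp only [Matrix.mul_apply]
  exact Differentiable.fun_sum fun k _ => (hf i k).mul (hg k j)

lemma differentiable_diagonal_zeroCpow {n : Type*} [DecidableEq n] (x : n → ℝ) {g : ℂ → ℂ}
    (hg : Differentiable ℂ g) (i j : n) :
    Differentiable ℂ fun z => (diagonal fun k => zeroCpow (x k) (g z) : Matrix n n ℂ) i j := by
  by_cases hij : i = j
  · subst hij
    simpa using differentiable_zeroCpow (x i) hg
  · simp [hij]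

lemma exists_norm_zeroCpow_le {n : Type*} [Fintype n] (q : ℝ) {x : n → ℝ}
    (hx : ∀ k, 0 ≤ x k) :
    ∃ c, 0 ≤ c ∧ ∀ w : ℂ, 0 ≤ w.re → w.re ≤ q → ∀ k, ‖zeroCpow (x k) w‖ ≤ c := by
  have hn (k : n) : 0 ≤ max 1 (x k) ^ q :=
    Real.rpow_nonneg (zero_le_one.trans (le_max_left _ _)) _
  exact ⟨∑ k, max 1 (x k) ^ q, Finset.sum_nonneg fun k _ => hn k, fun w h₀ h₁ k =>
    (norm_zeroCpow_le_max (hx k) h₀ h₁).trans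
      (Finset.single_le_sum (fun k _ => hn k) (Finset.mem_univ k))⟩

lemma sum_rpow_le_of_diag_eq {I J : Type*} [Fintype I] [Fintype J] [DecidableEq I]
    [DecidableEq J] {q T : ℝ} (hq : 1 ≤ q) {V W : Matrix I I ℂ} {P R : Matrix I J ℂ}
    (hV : ‖V‖ ≤ 1) (hW : ‖W‖ ≤ 1) (hP : ‖P‖ ≤ 1) (hR : ‖R‖ ≤ 1)
    {d s : I → ℝ} {b : J → ℝ} (hd : ∀ i, 0 ≤ d i) (hs : ∀ i, 0 ≤ s i) (hb : ∀ j, 0 ≤ b j)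
    (hPT : ∑ j, b j ^ q * ∑ i, s i ^ q * ‖P i j‖ ^ 2 ≤ T)
    (hRT : ∑ j, b j ^ q * ∑ i, s i ^ q * ‖R i j‖ ^ 2 ≤ T)
    (h : ∀ i, (V * (diagonal (fun i => (√(s i) : ℂ)) * P * diagonal (fun j => (b j : ℂ)) *
      (Rᴴ * diagonal (fun i => (√(s i) : ℂ)))) * W) i i = d i) :
    ∑ i, d i ^ q ≤ T := by
  have hq₀ : 0 < q := by linarith
  set D : ℂ → Matrix I I ℂ := fun z => diagonal fun i => zeroCpow (d i) (q * (1 - z)) with hDdef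
  set S : ℂ → Matrix I I ℂ := fun z => diagonal fun i => zeroCpow (s i) (q * z / 2) with hSdef
  set B : ℂ → Matrix J J ℂ := fun z => diagonal fun j => zeroCpow (b j) (q * z) with hBdef
  set N : ℂ → Matrix I I ℂ := fun z => V * (S z * P * B z * (Rᴴ * S z)) * W with hNdef
  set f : ℂ → ℂ := fun z => ∑ i, zeroCpow (d i) (q * (1 - z)) * N z i i with hfdef
  set F := ∑ i, d i ^ q with hF
  have hF₀ : 0 ≤ F := Finset.sum_nonneg fun i _ => Real.rpow_nonneg (hd i) _
  have hT₀ : 0 ≤ T := le_trans (Finset.sum_nonneg fun j _ => mul_nonneg (Real.rpow_nonneg (hb j) _)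
    (Finset.sum_nonneg fun i _ => mul_nonneg (Real.rpow_nonneg (hs i) _) (sq_nonneg _))) hPT
  have hSd := differentiable_diagonal_zeroCpow s (g := fun z => q * z / 2) (by fun_prop)
  have hBd := differentiable_diagonal_zeroCpow b (g := fun z => q * z) (by fun_prop)
  have hSPd := differentiable_matrix_mul (f := S) (g := fun _ => P) hSd
    fun _ _ => differentiable_const _
  have hRSd := differentiable_matrix_mul (f := fun _ => Rᴴ) (g := S)
    (fun _ _ => differentiable_const _) hSd
  have hSBSd := differentiable_matrix_mul (differentiable_matrix_mul (g := B) hSPd hBd) hRSd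
  have hNd := differentiable_matrix_mul (g := fun _ => W)
    (differentiable_matrix_mul (f := fun _ => V) (fun _ _ => differentiable_const _) hSBSd)
    fun _ _ => differentiable_const _
  have hfd : Differentiable ℂ f := Differentiable.fun_sum fun i _ =>
    (differentiable_zeroCpow (d i) (g := fun z => q * (1 - z)) (by fun_prop)).mul (hNd i i)
  have hNmul (z : ℂ) : ‖N z‖ ≤ ‖S z‖ * ‖B z‖ * ‖S z‖ := by
    have h₁ : ‖S z * P‖ ≤ ‖S z‖ :=
      (l2_opNorm_mul _ _).trans (mul_le_of_le_one_right (norm_nonneg _) hP)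
    have h₂ : ‖Rᴴ * S z‖ ≤ ‖S z‖ :=
      (l2_opNorm_mul _ _).trans
        (mul_le_of_le_one_left (norm_nonneg _) (by rwa [l2_opNorm_conjTranspose]))
    have h₃ : ‖S z * P * B z‖ ≤ ‖S z‖ * ‖B z‖ :=
      (l2_opNorm_mul _ _).trans (mul_le_mul_of_nonneg_right h₁ (norm_nonneg _))
    have h₄ : ‖S z * P * B z * (Rᴴ * S z)‖ ≤ ‖S z‖ * ‖B z‖ * ‖S z‖ :=
      (l2_opNorm_mul _ _).trans (mul_le_mul h₃ h₂ (norm_nonneg _) (by positivity))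
    exact (l2_opNorm_mul _ _).trans <| (mul_le_of_le_one_right (norm_nonneg _) hW).trans <|
      (l2_opNorm_mul _ _).trans <| (mul_le_of_le_one_left (norm_nonneg _) hV).trans h₄
  have hf₀ : ∀ z ∈ Complex.re ⁻¹' {(0 : ℝ)}, ‖f z‖ ≤ F := by
    intro z hz
    have hz : z.re = 0 := hz
    have hS : ‖S z‖ ≤ 1 := by
      rw [hSdef, l2_opNorm_diagonal, pi_norm_le_iff_of_nonneg zero_le_one]
      exact fun i => norm_zeroCpow_le_one (hs i) (by simp [hz])
    have hB : ‖B z‖ ≤ 1 := by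
      rw [hBdef, l2_opNorm_diagonal, pi_norm_le_iff_of_nonneg zero_le_one]
      exact fun i => norm_zeroCpow_le_one (hb i) (by simp [hz])
    have hN : ‖N z‖ ≤ 1 := (hNmul z).trans
      (mul_le_one₀ (mul_le_one₀ hS (norm_nonneg _) hB) (norm_nonneg _) hS)
    refine (norm_sum_le _ _).trans (Finset.sum_le_sum fun i _ => ?_)
    rw [norm_mul]
    refine (mul_le_of_le_one_right (norm_nonneg _)
      ((norm_entry_le_l2_opNorm _ i i).trans hN)).trans ?_
    simpa [hz] using norm_zeroCpow_le (hd i) (q * (1 - z))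
  have hf₁ : ∀ z ∈ Complex.re ⁻¹' {(1 : ℝ)}, ‖f z‖ ≤ T := by
    intro z hz
    have hz : z.re = 1 := hz
    have hD : ‖D z‖ ≤ 1 := by
      rw [hDdef, l2_opNorm_diagonal, pi_norm_le_iff_of_nonneg zero_le_one]
      exact fun i => norm_zeroCpow_le_one (hd i) (by simp [hz])
    set C := W * D z * V with hC
    have hC₁ : ‖C‖ ≤ 1 := (l2_opNorm_mul _ _).trans <| mul_le_one₀
      ((l2_opNorm_mul _ _).trans (mul_le_one₀ hW (norm_nonneg _) hD)) (norm_nonneg _) hV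
    have hftr : f z = ∑ j, zeroCpow (b j) (q * z) *
        ((fun i => (Rᴴ * S z) j i) ⬝ᵥ C *ᵥ fun i => (S z * P) i j) := by
      have h₁ : f z = trace (D z * N z) := by
        simp [hfdef, trace, hDdef, diagonal_mul]
      have h₂ : trace (D z * N z) = trace (B z * ((Rᴴ * S z) * C * (S z * P))) := by
        calc trace (D z * N z)
            = trace ((D z * V * (S z * P)) * (B z * (Rᴴ * S z) * W)) := by
              simp only [hNdef, Matrix.mul_assoc]
          _ = trace ((B z * (Rᴴ * S z) * W) * (D z * V * (S z * P))) := trace_mul_comm _ _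
          _ = _ := by simp only [hC, Matrix.mul_assoc]
      rw [h₁, h₂]
      simp only [trace, diag_apply, hBdef, diagonal_mul]
      refine Finset.sum_congr rfl fun j _ => ?_
      congr 1
      rw [Matrix.mul_assoc, Matrix.mul_apply]
      rfl
    have hSP (M : Matrix I J ℂ) (i : I) (j : J) :
        ‖(S z * M) i j‖ ^ 2 ≤ s i ^ q * ‖M i j‖ ^ 2 := by
      have h₁ := norm_zeroCpow_le (hs i) (q * z / 2)
      have h₂ : ((q : ℂ) * z / 2).re = q / 2 := by
        simp [hz]
      rw [h₂] at h₁
      rw [hSdef, diagonal_mul, norm_mul, mul_pow]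
      refine mul_le_mul_of_nonneg_right ?_ (sq_nonneg _)
      calc _ ≤ (s i ^ (q / 2)) ^ 2 := pow_le_pow_left₀ (norm_nonneg _) h₁ 2
        _ = s i ^ q := by
          rw [← Real.rpow_natCast, ← Real.rpow_mul (hs i)]
          norm_num
    have hRS (i : I) (j : J) : ‖(Rᴴ * S z) j i‖ ^ 2 ≤ s i ^ q * ‖R i j‖ ^ 2 := by
      have h₁ := hSP R i j
      rw [hSdef, diagonal_mul] at h₁
      rw [hSdef, mul_diagonal, conjTranspose_apply, norm_mul, norm_star, mul_comm, ← norm_mul]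
      exact h₁
    rw [hftr]
    calc _ ≤ ∑ j, b j ^ q * ((∑ i, s i ^ q * ‖R i j‖ ^ 2 + ∑ i, s i ^ q * ‖P i j‖ ^ 2) / 2) := by
          refine (norm_sum_le _ _).trans (Finset.sum_le_sum fun j _ => ?_)
          rw [norm_mul]
          refine mul_le_mul ?_ ((norm_dotProduct_mulVec_le C _ _).trans
            ((mul_le_of_le_one_left (by positivity) hC₁).trans ?_)) (norm_nonneg _)
            (Real.rpow_nonneg (hb j) _)
          · simpa [hz] using norm_zeroCpow_le (hb j) (q * z)
          · gcongr with i _ i _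
            · exact hRS i j
            · exact hSP P i j
      _ = (∑ j, b j ^ q * ∑ i, s i ^ q * ‖R i j‖ ^ 2 +
            ∑ j, b j ^ q * ∑ i, s i ^ q * ‖P i j‖ ^ 2) / 2 := by
          rw [← Finset.sum_add_distrib, Finset.sum_div]
          exact Finset.sum_congr rfl fun j _ => by ring
      _ ≤ T := by linarith
  have hbdd : BddAbove ((norm ∘ f) '' Complex.HadamardThreeLines.verticalClosedStrip 0 1) := by
    obtain ⟨cd, hcd, hd'⟩ := exists_norm_zeroCpow_le q hd
    obtain ⟨cs, hcs, hs'⟩ := exists_norm_zeroCpow_le q hs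
    obtain ⟨cb, hcb, hb'⟩ := exists_norm_zeroCpow_le q hb
    refine ⟨∑ _i : I, cd * (cs * cb * cs), ?_⟩
    rintro _ ⟨z, ⟨hz₀, hz₁⟩, rfl⟩
    have hS : ‖S z‖ ≤ cs := by
      rw [hSdef, l2_opNorm_diagonal, pi_norm_le_iff_of_nonneg hcs]
      refine hs' _ ?_ ?_ <;> simp <;> nlinarith
    have hB : ‖B z‖ ≤ cb := by
      rw [hBdef, l2_opNorm_diagonal, pi_norm_le_iff_of_nonneg hcb]
      refine hb' _ ?_ ?_ <;> simp <;> nlinarith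
    refine (norm_sum_le _ _).trans (Finset.sum_le_sum fun i _ => ?_)
    rw [norm_mul]
    refine mul_le_mul (hd' _ ?_ ?_ i) ?_ (norm_nonneg _) hcd
    · simp
      nlinarith
    · simp
      nlinarith
    · refine (norm_entry_le_l2_opNorm _ i i).trans ((hNmul z).trans ?_)
      gcongr
  have hmem : ((1 / q : ℝ) : ℂ) ∈ Complex.HadamardThreeLines.verticalClosedStrip 0 1 := by
    constructor
    · simp; positivity
    · simpa using inv_le_one_of_one_le₀ hq
  have hfq : f ((1 / q : ℝ) : ℂ) = F := by
    have e₁ : (q : ℂ) * (1 - ((1 / q : ℝ) : ℂ)) = ((q - 1 : ℝ) : ℂ) := by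
      norm_cast
      field_simp
    have e₂ : (q : ℂ) * ((1 / q : ℝ) : ℂ) = ((1 : ℝ) : ℂ) := by
      norm_cast
      field_simp
    have e₃ : (q : ℂ) * ((1 / q : ℝ) : ℂ) / 2 = ((1 / 2 : ℝ) : ℂ) := by
      rw [e₂]; simp
    have hS : S ((1 / q : ℝ) : ℂ) = diagonal fun i => (√(s i) : ℂ) := by
      simp only [hSdef, e₃]
      congr 1
      ext i
      rw [zeroCpow_ofReal (hs i) (by norm_num), ← Real.sqrt_eq_rpow]
    have hB : B ((1 / q : ℝ) : ℂ) = diagonal fun j => (b j : ℂ) := by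
      simp only [hBdef, e₂]
      congr 1
      ext j
      rw [zeroCpow_ofReal (hb j) one_pos, Real.rpow_one]
    simp only [hfdef, hNdef, hS, hB, h, e₁, hF]
    rw [Complex.ofReal_sum]
    exact Finset.sum_congr rfl fun i _ => zeroCpow_mul_self (hd i) hq₀
  have key := Complex.HadamardThreeLines.norm_le_interp_of_mem_verticalClosedStrip₀₁' f hmem
    hfd.diffContOnCl hbdd hf₀ hf₁
  rw [hfq, Complex.norm_real, Real.norm_of_nonneg hF₀, Complex.ofReal_re] at key
  rcases hF₀.eq_or_lt with h0 | h0
  · rwa [← h0]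
  · rw [Real.rpow_sub h0, Real.rpow_one, div_mul_eq_mul_div, le_div_iff₀ (by positivity)] at key
    have := le_of_mul_le_mul_left key h0
    exact (Real.rpow_le_rpow_iff hF₀ hT₀ (by positivity)).1 this

end Interpolation

section PolarFactors

open scoped Matrix

lemma exists_eq_mul_diagonal {m n : Type*} [Fintype m] [Fintype n] [DecidableEq n]
    {M : Matrix m n ℂ} {r : n → ℝ} (h : Mᴴ * M = diagonal fun i => ((r i ^ 2 : ℝ) : ℂ)) :
    ∃ V : Matrix m n ℂ, M = V * diagonal (fun i => (r i : ℂ)) ∧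
      Vᴴ * V = diagonal fun i => if r i = 0 then 0 else 1 := by
  refine ⟨M * diagonal (fun i => ((r i)⁻¹ : ℂ)), ?_, ?_⟩
  · have hcol (j : n) (hj : r j = 0) (i : m) : M i j = 0 := by
      have h₁ : (∑ k, ‖M k j‖ ^ 2 : ℝ) = 0 := by
        have h₂ := congrFun (congrFun h j) j
        simp only [mul_apply, conjTranspose_apply, diagonal_apply_eq, hj] at h₂
        have h₃ (k : m) : star (M k j) * M k j = ((‖M k j‖ ^ 2 : ℝ) : ℂ) := by
          rw [Complex.star_def, Complex.conj_mul']
          norm_cast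
        simp only [h₃] at h₂
        exact_mod_cast (by simpa using h₂ : ∑ k, ((‖M k j‖ : ℂ) ^ 2) = 0)
      have h₂ := (Finset.sum_eq_zero_iff_of_nonneg fun k _ => sq_nonneg ‖M k j‖).1 h₁ i
        (Finset.mem_univ i)
      simpa using h₂
    ext i j
    rw [mul_diagonal, mul_diagonal]
    by_cases hj : r j = 0
    · simp [hcol j hj i]
    · rw [mul_assoc, inv_mul_cancel₀ (by exact_mod_cast hj), mul_one]
  · rw [conjTranspose_mul, diagonal_conjTranspose, Matrix.mul_assoc, ← Matrix.mul_assoc Mᴴ, h,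
      diagonal_mul_diagonal, diagonal_mul_diagonal]
    congr 1
    ext i
    by_cases hi : r i = 0
    · simp [hi]
    · have : (r i : ℂ) ≠ 0 := by exact_mod_cast hi
      simp [hi]
      field_simp

lemma Matrix.IsHermitian.exists_unitary_conj_eq_diagonal {n : Type*} [Fintype n]
    [DecidableEq n] {H : Matrix n n ℂ} (hH : H.IsHermitian) :
    ∃ W : Matrix n n ℂ, Wᴴ * W = 1 ∧ W * Wᴴ = 1 ∧
      H = W * diagonal (fun i => (hH.eigenvalues i : ℂ)) * Wᴴ := by
  refine ⟨hH.eigenvectorUnitary, Unitary.coe_star_mul_self _, Unitary.coe_mul_star_self _, ?_⟩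
  conv_lhs => rw [hH.spectral_theorem]
  rfl

/-- A singular value decomposition of a square matrix, whose left factor is only a partial
isometry, together with the resulting formula for the Schatten norms. -/
lemma exists_singularValues {n : Type*} [Fintype n] [DecidableEq n] (M : Matrix n n ℂ) :
    ∃ (V W : Matrix n n ℂ) (σ : n → ℝ), (∀ i, 0 ≤ σ i) ∧ Wᴴ * W = 1 ∧ W * Wᴴ = 1 ∧
      (Vᴴ * V = diagonal fun i => if σ i = 0 then 0 else 1) ∧
      M = V * diagonal (fun i => (σ i : ℂ)) * Wᴴ ∧
      Mᴴ * M = W * diagonal (fun i => ((σ i ^ 2 : ℝ) : ℂ)) * Wᴴ ∧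
      ∀ q, schattenNorm q M = (∑ i, σ i ^ q) ^ (1 / q) := by
  have hpos := posSemidef_conjTranspose_mul_self M
  obtain ⟨W, hW, hW', hM⟩ := hpos.1.exists_unitary_conj_eq_diagonal
  have hsq (i : n) : √(hpos.1.eigenvalues i) ^ 2 = hpos.1.eigenvalues i :=
    Real.sq_sqrt (hpos.eigenvalues_nonneg i)
  have hMW : (M * W)ᴴ * (M * W) = diagonal fun i => ((√(hpos.1.eigenvalues i) ^ 2 : ℝ) : ℂ) := by
    simp only [hsq]
    calc (M * W)ᴴ * (M * W) = Wᴴ * (Mᴴ * M) * W := by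
          rw [conjTranspose_mul]
          simp only [Matrix.mul_assoc]
      _ = (Wᴴ * W) * diagonal (fun i => (hpos.1.eigenvalues i : ℂ)) * (Wᴴ * W) := by
          conv_lhs => rw [hM]
          simp only [Matrix.mul_assoc]
      _ = _ := by rw [hW, Matrix.one_mul, Matrix.mul_one]
  obtain ⟨V, hV, hVV⟩ := exists_eq_mul_diagonal hMW
  refine ⟨V, W, fun i => √(hpos.1.eigenvalues i), fun i => Real.sqrt_nonneg _, hW, hW', hVV,
    ?_, ?_, fun q => ?_⟩
  · rw [← hV, Matrix.mul_assoc, hW', Matrix.mul_one]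
  · simpa only [hsq] using hM
  · unfold schattenNorm
    congr 1
    refine Finset.sum_congr rfl fun i _ => ?_
    change _ = √(hpos.1.eigenvalues i) ^ q
    rw [Real.sqrt_eq_rpow, ← Real.rpow_mul (hpos.eigenvalues_nonneg i)]
    congr 1
    ring

open scoped MatrixOrder Matrix.Norms.L2Operator in
lemma Matrix.PosSemidef.exists_diagonalization_schattenNorm {n : Type*} [Fintype n]
    [DecidableEq n] {S : Matrix n n ℂ} (hS : S.PosSemidef) :
    ∃ (W : Matrix n n ℂ) (s : n → ℝ), (∀ i, 0 ≤ s i) ∧ Wᴴ * W = 1 ∧ W * Wᴴ = 1 ∧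
      S = W * diagonal (fun i => (s i : ℂ)) * Wᴴ ∧
      ∀ q, schattenNorm q S = (∑ i, s i ^ q) ^ (1 / q) := by
  obtain ⟨V, W, s, hs, hW, hW', -, -, hSS, hq⟩ := exists_singularValues S
  refine ⟨W, s, hs, hW, hW', ?_, hq⟩
  set S' := W * diagonal (fun i => (s i : ℂ)) * Wᴴ with hS'
  have hS'pos : S'.PosSemidef := by
    have hd : (diagonal fun i => (s i : ℂ)).PosSemidef :=
      posSemidef_diagonal_iff.2 fun i => by exact_mod_cast hs i
    exact hd.mul_mul_conjTranspose_same W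
  have hsq : S' * S' = S * S := by
    have h₁ : S * S = W * diagonal (fun i => ((s i ^ 2 : ℝ) : ℂ)) * Wᴴ := by
      rw [← hSS, hS.1.eq]
    calc S' * S' = W * (diagonal (fun i => (s i : ℂ)) * (Wᴴ * W) *
            diagonal (fun i => (s i : ℂ))) * Wᴴ := by
          simp only [hS', Matrix.mul_assoc]
      _ = S * S := by
          rw [hW, Matrix.mul_one, diagonal_mul_diagonal, h₁]
          simp only [sq, Complex.ofReal_mul]
  have h₁ := CFC.sqrt_unique (a := S * S) rfl (nonneg_iff_posSemidef.2 hS)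
  have h₂ := CFC.sqrt_unique hsq (nonneg_iff_posSemidef.2 hS'pos)
  rw [← h₁, h₂]

end PolarFactors

section KroneckerBlocks

open scoped Matrix Matrix.Norms.L2Operator

/-- The block row indexed by `k` whose blocks are `(star (Q k)) ⊗ U k`, where `Q k` is the `k`-th
row of `Q`. -/
noncomputable def kroneckerBlocks {κ m n : Type*} (Q : Matrix κ n ℂ) (U : κ → Matrix m m ℂ) :
    Matrix (n × m) (κ × m) ℂ :=
  of fun x y => star (Q y.1 x.1) * U y.1 x.2 y.2

lemma kroneckerBlocks_mul {κ m n : Type*}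
    [Fintype m] [Fintype n] [DecidableEq m]
    (Q : Matrix κ n ℂ) (M : Matrix n n ℂ) (U : κ → Matrix m m ℂ) :
    kroneckerBlocks (Q * M) U = (Mᴴ ⊗ₖ (1 : Matrix m m ℂ)) * kroneckerBlocks Q U := by
  ext ⟨a, r⟩ ⟨k, l⟩
  simp [kroneckerBlocks, mul_apply, Fintype.sum_prod_type, one_apply, Finset.mul_sum, mul_comm,
    mul_left_comm]

lemma norm_kroneckerBlocks_le_one {κ m n : Type*}
    [Fintype κ] [Fintype m] [Fintype n] [DecidableEq κ] [DecidableEq m] [DecidableEq n]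
    {Q : Matrix κ n ℂ} {U : κ → Matrix m m ℂ} {v : n → ℂ}
    {u : κ → m → ℂ} (hQ : Qᴴ * Q = diagonal v) (hv : ∀ a, ‖v a‖ ≤ 1)
    (hU : ∀ k, (U k)ᴴ * U k = diagonal (u k)) (hu : ∀ k l, ‖u k l‖ ≤ 1) :
    ‖kroneckerBlocks Q U‖ ≤ 1 := by
  set E : Matrix (κ × m) (κ × m) ℂ := of fun x y => if x.1 = y.1 then U y.1 x.2 y.2 else 0
  have hE : ‖E‖ ≤ 1 := by
    refine l2_opNorm_le_one_of_conjTranspose_mul_self_eq_diagonal (v := fun y => u y.1 y.2) ?_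
      fun y => hu y.1 y.2
    ext ⟨k, l⟩ ⟨k', l'⟩
    have h := congrFun (congrFun (hU k) l) l'
    by_cases hk : k = k'
    · subst hk
      simpa [E, mul_apply, Fintype.sum_prod_type, diagonal_apply] using h
    · simp [E, mul_apply, Fintype.sum_prod_type, hk, Ne.symm hk]
  have hQ₁ : ‖Qᴴ ⊗ₖ (1 : Matrix m m ℂ)‖ ≤ 1 := by
    have h : (Qᴴ ⊗ₖ (1 : Matrix m m ℂ)) = (Q ⊗ₖ (1 : Matrix m m ℂ))ᴴ := by
      rw [conjTranspose_kronecker, conjTranspose_one]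
    rw [h, l2_opNorm_conjTranspose]
    refine l2_opNorm_le_one_of_conjTranspose_mul_self_eq_diagonal (v := fun x => v x.1) ?_
      fun x => hv x.1
    rw [← h, ← mul_kronecker_mul, hQ, Matrix.one_mul, ← diagonal_one, diagonal_kronecker_diagonal]
    simp
  have hfac : kroneckerBlocks Q U = (Qᴴ ⊗ₖ (1 : Matrix m m ℂ)) * E := by
    ext ⟨a, r⟩ ⟨k, l⟩
    simp [kroneckerBlocks, E, mul_apply, Fintype.sum_prod_type, one_apply]
  rw [hfac]
  exact (l2_opNorm_mul _ _).trans (mul_le_one₀ hQ₁ (norm_nonneg _) hE)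

lemma sum_norm_sq_col_le_one_s1 {m n : Type*}
    [Fintype m] [DecidableEq n]
    {M : Matrix m n ℂ} {v : n → ℂ} (h : Mᴴ * M = diagonal v)
    (hv : ∀ j, ‖v j‖ ≤ 1) (j : n) : ∑ i, ‖M i j‖ ^ 2 ≤ 1 := by
  have h₁ : ((∑ i, ‖M i j‖ ^ 2 : ℝ) : ℂ) = v j := by
    rw [← diagonal_apply_eq v j, ← h, mul_apply, Complex.ofReal_sum]
    refine Finset.sum_congr rfl fun i _ => ?_
    rw [conjTranspose_apply, Complex.star_def, Complex.conj_mul', Complex.ofReal_pow]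
  have h₂ := hv j
  rw [← h₁, Complex.norm_real] at h₂
  exact (le_abs_self _).trans h₂

lemma sum_norm_sq_kroneckerBlocks_le {κ m n : Type*}
    [Fintype κ] [Fintype m] [Fintype n] [DecidableEq m] [DecidableEq n]
    {Q : Matrix κ n ℂ} {U : κ → Matrix m m ℂ} {v : n → ℂ}
    {u : κ → m → ℂ} (hQ : Qᴴ * Q = diagonal v) (hv : ∀ a, ‖v a‖ ≤ 1)
    (hU : ∀ k, (U k)ᴴ * U k = diagonal (u k)) (hu : ∀ k l, ‖u k l‖ ≤ 1) {t : κ × m → ℝ}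
    (ht : ∀ y, 0 ≤ t y) (ht₁ : ∀ k, ∑ l, t (k, l) ≤ 1) {w : n → ℝ} (hw : ∀ a, 0 ≤ w a) :
    ∑ y, t y * ∑ x : n × m, w x.1 * ‖kroneckerBlocks Q U x y‖ ^ 2 ≤ ∑ a, w a := by
  calc ∑ y, t y * ∑ x : n × m, w x.1 * ‖kroneckerBlocks Q U x y‖ ^ 2
      = ∑ y : κ × m, t y * ((∑ a, w a * ‖Q y.1 a‖ ^ 2) * ∑ r, ‖U y.1 r y.2‖ ^ 2) := by
        refine Finset.sum_congr rfl fun y _ => ?_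
        rw [Fintype.sum_prod_type, Finset.sum_mul]
        simp only [kroneckerBlocks, of_apply, norm_mul, norm_star, mul_pow, Finset.mul_sum,
          mul_assoc]
    _ ≤ ∑ y : κ × m, t y * ∑ a, w a * ‖Q y.1 a‖ ^ 2 := by
        refine Finset.sum_le_sum fun y _ => mul_le_mul_of_nonneg_left ?_ (ht y)
        exact mul_le_of_le_one_right
          (Finset.sum_nonneg fun a _ => mul_nonneg (hw a) (sq_nonneg _))
          (sum_norm_sq_col_le_one_s1 (hU y.1) (hu y.1) y.2)
    _ = ∑ k, (∑ l, t (k, l)) * ∑ a, w a * ‖Q k a‖ ^ 2 := by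
        rw [Fintype.sum_prod_type]
        simp only [Finset.sum_mul]
    _ ≤ ∑ k, ∑ a, w a * ‖Q k a‖ ^ 2 := by
        refine Finset.sum_le_sum fun k _ => mul_le_of_le_one_left
          (Finset.sum_nonneg fun a _ => mul_nonneg (hw a) (sq_nonneg _)) (ht₁ k)
    _ = ∑ a, w a * ∑ k, ‖Q k a‖ ^ 2 := by
        rw [Finset.sum_comm]
        simp only [Finset.mul_sum]
    _ ≤ ∑ a, w a := Finset.sum_le_sum fun a _ =>
        mul_le_of_le_one_right (hw a) (sum_norm_sq_col_le_one_s1 hQ hv a)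

lemma kroneckerBlocks_mul_diagonal_mul {κ m n : Type*}
    [Fintype κ] [Fintype m] [DecidableEq κ] [DecidableEq m]
    (R : Matrix κ n ℂ) (U W : κ → Matrix m m ℂ)
    (τ : κ × m → ℂ) :
    kroneckerBlocks R U * diagonal τ * (kroneckerBlocks R W)ᴴ =
      ∑ k, vecMulVec (star (R k)) (R k) ⊗ₖ
        (U k * diagonal (fun l => τ (k, l)) * (W k)ᴴ) := by
  ext ⟨a, r⟩ ⟨a', r'⟩
  rw [Matrix.mul_apply, Matrix.sum_apply, Fintype.sum_prod_type]
  refine Finset.sum_congr rfl fun k _ => ?_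
  rw [kroneckerMap_apply, Matrix.mul_apply, Finset.mul_sum]
  refine Finset.sum_congr rfl fun l _ => ?_
  simp only [mul_diagonal, kroneckerBlocks, of_apply, conjTranspose_apply, vecMulVec_apply,
    star_mul', star_star, Pi.star_apply]
  ring

lemma schattenNorm_kroneckerBlocks_le {κ m n : Type*}
    [Fintype κ] [Fintype m] [Fintype n] [DecidableEq κ] [DecidableEq m] [DecidableEq n]
    {q : ℝ} (hq : 1 ≤ q) {R : Matrix κ n ℂ}
    {U W : κ → Matrix m m ℂ} {u w : κ → m → ℂ} (hU : ∀ k, (U k)ᴴ * U k = diagonal (u k))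
    (hu : ∀ k l, ‖u k l‖ ≤ 1) (hW : ∀ k, (W k)ᴴ * W k = diagonal (w k))
    (hw : ∀ k l, ‖w k l‖ ≤ 1) {τ : κ × m → ℝ} (hτ : ∀ y, 0 ≤ τ y)
    (hτ₁ : ∀ k, ∑ l, τ (k, l) ^ q ≤ 1) :
    schattenNorm q (kroneckerBlocks R U * diagonal (fun y => (τ y : ℂ)) *
      (kroneckerBlocks R W)ᴴ) ≤ schattenNorm q (Rᴴ * R) := by
  set X := kroneckerBlocks R U * diagonal (fun y => (τ y : ℂ)) * (kroneckerBlocks R W)ᴴ with hX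
  have hite (p : Prop) [Decidable p] : ‖(if p then 0 else 1 : ℂ)‖ ≤ 1 := by
    split_ifs <;> simp
  obtain ⟨Z, s, hs, hZ, hZ', hS, hSq⟩ :=
    (posSemidef_conjTranspose_mul_self R).exists_diagonalization_schattenNorm
  obtain ⟨V, Y, σ, hσ, hY, hY', hV, hXσ, -, hXq⟩ := exists_singularValues X
  have hRZ : (R * Z)ᴴ * (R * Z) = diagonal fun i => ((√(s i) ^ 2 : ℝ) : ℂ) := by
    simp only [Real.sq_sqrt (hs _)]
    calc (R * Z)ᴴ * (R * Z) = Zᴴ * (Rᴴ * R) * Z := by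
          rw [conjTranspose_mul]
          simp only [Matrix.mul_assoc]
      _ = (Zᴴ * Z) * diagonal (fun i => (s i : ℂ)) * (Zᴴ * Z) := by
          rw [hS]
          simp only [Matrix.mul_assoc]
      _ = _ := by rw [hZ, Matrix.one_mul, Matrix.mul_one]
  obtain ⟨Q, hRQ, hQ⟩ := exists_eq_mul_diagonal hRZ
  have hR : R = Q * (diagonal (fun i => (√(s i) : ℂ)) * Zᴴ) := by
    rw [← Matrix.mul_assoc, ← hRQ, Matrix.mul_assoc, hZ', Matrix.mul_one]
  set Z₁ : Matrix (n × m) (n × m) ℂ := Z ⊗ₖ (1 : Matrix m m ℂ) with hZ₁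
  have hblocks (G : κ → Matrix m m ℂ) : kroneckerBlocks R G =
      Z₁ * (diagonal (fun x : n × m => (√(s x.1) : ℂ)) * kroneckerBlocks Q G) := by
    rw [hR, kroneckerBlocks_mul, conjTranspose_mul, conjTranspose_conjTranspose,
      diagonal_conjTranspose, ← Matrix.mul_assoc, hZ₁]
    congr 1
    rw [← Matrix.mul_one (1 : Matrix m m ℂ), mul_kronecker_mul, Matrix.mul_one,
      ← diagonal_one, diagonal_kronecker_diagonal]
    congr 2
    ext x
    simp [Pi.star_apply, Complex.conj_ofReal]
  have hZ₁Z₁ : Z₁ᴴ * Z₁ = 1 := by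
    rw [hZ₁, conjTranspose_kronecker, ← mul_kronecker_mul, hZ, conjTranspose_one, Matrix.one_mul,
      one_kronecker_one]
  have hone {k : Type _} [Fintype k] [DecidableEq k] {M : Matrix k k ℂ} (h : Mᴴ * M = 1) :
      ‖M‖ ≤ 1 :=
    l2_opNorm_le_one_of_conjTranspose_mul_self_eq_diagonal (h.trans diagonal_one.symm) (by simp)
  have hZn := hone hZ₁Z₁
  have hVn : ‖V‖ ≤ 1 :=
    l2_opNorm_le_one_of_conjTranspose_mul_self_eq_diagonal hV fun i => hite _
  have key := sum_rpow_le_of_diag_eq (q := q) (T := ∑ a, s a ^ q) (V := Vᴴ * Z₁) (W := Z₁ᴴ * Y)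
    (P := kroneckerBlocks Q U) (R := kroneckerBlocks Q W) (d := σ) (s := fun x => s x.1) (b := τ)
    hq
    ((l2_opNorm_mul _ _).trans
      (mul_le_one₀ ((l2_opNorm_conjTranspose V).trans_le hVn) (norm_nonneg _) hZn))
    ((l2_opNorm_mul _ _).trans
      (mul_le_one₀ ((l2_opNorm_conjTranspose Z₁).trans_le hZn) (norm_nonneg _) (hone hY)))
    (norm_kroneckerBlocks_le_one hQ (fun _ => hite _) hU hu)
    (norm_kroneckerBlocks_le_one hQ (fun _ => hite _) hW hw)
    hσ (fun x => hs x.1) hτ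
    (sum_norm_sq_kroneckerBlocks_le hQ (fun _ => hite _) hU hu
      (fun y => Real.rpow_nonneg (hτ y) q) hτ₁ fun a => Real.rpow_nonneg (hs a) q)
    (sum_norm_sq_kroneckerBlocks_le hQ (fun _ => hite _) hW hw
      (fun y => Real.rpow_nonneg (hτ y) q) hτ₁ fun a => Real.rpow_nonneg (hs a) q)
    ?_
  · rw [hXq, hSq]
    exact Real.rpow_le_rpow (Finset.sum_nonneg fun i _ => Real.rpow_nonneg (hσ i) q) key
      (by positivity)
  · have hVXY : Vᴴ * X * Y = diagonal fun i => (σ i : ℂ) := by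
      calc Vᴴ * X * Y = (Vᴴ * V) * diagonal (fun i => (σ i : ℂ)) * (Yᴴ * Y) := by
            conv_lhs => rw [hXσ]
            simp only [Matrix.mul_assoc]
        _ = _ := by
            rw [hV, hY, Matrix.mul_one, diagonal_mul_diagonal]
            congr 1
            ext i
            by_cases hi : σ i = 0 <;> simp [hi]
    intro i
    rw [← diagonal_apply_eq (fun i => (σ i : ℂ)) i, ← hVXY, hX, hblocks U, hblocks W]
    simp only [conjTranspose_mul, diagonal_conjTranspose, Matrix.mul_assoc]
    have hstar : star (fun x : n × m => (√(s x.1) : ℂ)) = fun x => (√(s x.1) : ℂ) := by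
      ext x
      simp [Pi.star_apply, Complex.conj_ofReal]
    rw [hstar]

end KroneckerBlocks

/-- For PSD matrices `A k` and arbitrary matrices `B k`, and `q ≥ 1`,
`‖Σ_k A_k ⊗ B_k‖_q ≤ ‖Σ_k ‖B_k‖_q · A_k‖_q`. -/
theorem schatten_sum_kronecker_le' (d m K : ℕ) (q : ℝ) (hq : 1 ≤ q)
    (A : Fin K → Matrix (Fin d) (Fin d) ℂ) (B : Fin K → Matrix (Fin m) (Fin m) ℂ)
    (hA : ∀ k, (A k).PosSemidef) :
    schattenNorm q (∑ k, A k ⊗ₖ B k) ≤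
      schattenNorm q (∑ k, (schattenNorm q (B k) : ℂ) • A k) := by
  have hq₀ : 0 < q := by linarith
  choose U W σ hσ hW _ hU hB _ hBq using fun k => exists_singularValues (B k)
  choose Z s hs _ _ hAs _ using fun k => (hA k).exists_diagonalization_schattenNorm
  set β : Fin K → ℝ := fun k => schattenNorm q (B k) with hβ
  have hsum (k : Fin K) : 0 ≤ ∑ l, σ k l ^ q :=
    Finset.sum_nonneg fun l _ => Real.rpow_nonneg (hσ k l) q
  have hβ₀ (k : Fin K) : 0 ≤ β k := by
    simp only [hβ, hBq]
    exact Real.rpow_nonneg (hsum k) _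
  have hβq (k : Fin K) : β k ^ q = ∑ l, σ k l ^ q := by
    simp only [hβ, hBq]
    rw [← Real.rpow_mul (hsum k), one_div_mul_cancel hq₀.ne', Real.rpow_one]
  have hσβ (k : Fin K) (l : Fin m) : β k * (σ k l / β k) = σ k l := by
    rcases eq_or_ne (β k) 0 with h | h
    · have h₁ := hβq k
      rw [h, Real.zero_rpow hq₀.ne'] at h₁
      have h₂ := (Finset.sum_eq_zero_iff_of_nonneg
        fun l _ => Real.rpow_nonneg (hσ k l) q).1 h₁.symm l (Finset.mem_univ l)
      rw [h, zero_mul, (Real.rpow_eq_zero (hσ k l) hq₀.ne').1 h₂]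
    · exact mul_div_cancel₀ _ h
  set R : Matrix (Fin K × Fin d) (Fin d) ℂ :=
    of fun x a => (√(β x.1 * s x.1 x.2) : ℂ) * star (Z x.1 a x.2) with hR
  have hRA (k : Fin K) :
      ∑ c, vecMulVec (star (R (k, c))) (R (k, c)) = (β k : ℂ) • A k := by
    ext a a'
    rw [hAs k, Matrix.smul_apply, Matrix.mul_apply, Matrix.sum_apply, Finset.smul_sum]
    refine Finset.sum_congr rfl fun c _ => ?_
    have h : (√(β k * s k c) : ℂ) * √(β k * s k c) = β k * s k c := by
      rw [← Complex.ofReal_mul, Real.mul_self_sqrt (mul_nonneg (hβ₀ k) (hs k c)),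
        Complex.ofReal_mul]
    simp only [vecMulVec_apply, Pi.star_apply, hR, of_apply, star_mul', Complex.conj_conj,
      mul_diagonal, conjTranspose_apply, smul_eq_mul, Complex.star_def, Complex.conj_ofReal]
    linear_combination (Z k a c * (starRingEnd ℂ) (Z k a' c)) * h
  have key := schattenNorm_kroneckerBlocks_le hq (R := R) (U := fun x => U x.1)
    (W := fun x => W x.1) (τ := fun y => σ y.1.1 y.2 / β y.1.1) (fun x => hU x.1)
    (fun x l => by split_ifs <;> simp) (fun x => (hW x.1).trans diagonal_one.symm)
    (fun x l => by simp) (fun y => div_nonneg (hσ _ _) (hβ₀ _)) (fun x => by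
      simp only [Real.div_rpow (hσ _ _) (hβ₀ _), ← Finset.sum_div, ← hβq]
      exact div_self_le_one _)
  rw [kroneckerBlocks_mul_diagonal_mul, Fintype.sum_prod_type] at key
  convert key using 2
  · refine Finset.sum_congr rfl fun k _ => ?_
    have h : (B k) = (β k : ℂ) • (U k * diagonal (fun l => ((σ k l / β k : ℝ) : ℂ)) * (W k)ᴴ) := by
      conv_lhs => rw [hB k]
      rw [← Matrix.smul_mul, ← Matrix.mul_smul, ← diagonal_smul]
      congr 3
      ext l
      rw [Pi.smul_apply, smul_eq_mul, ← Complex.ofReal_mul, hσβ]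
    conv_lhs => rw [h]
    rw [kronecker_smul, ← smul_kronecker, ← hRA k]
    ext x y
    simp [Matrix.sum_apply, Finset.sum_mul]
  · ext a a'
    rw [Matrix.mul_apply, Fintype.sum_prod_type, Matrix.sum_apply]
    refine Finset.sum_congr rfl fun k _ => ?_
    rw [← hRA k, Matrix.sum_apply]
    rfl
end

section
/- Let q ≥ 1 and let ρ = [[B, C],[C†, D]] be a positive semidefinite block matrix, where B is a d_1×d_1 block, D is a d_2×d_2 block, and C is d_1×d_2. Then ‖ρ‖_q ≤ ‖B‖_q + ‖D‖_q. -/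
open scoped Kronecker ComplexOrder
open Matrix

namespace Matrix

variable {m n : Type*} [Fintype m] [Fintype n] [DecidableEq m] [DecidableEq n]

/-- Sums of a function over the eigenvalues of a Hermitian matrix are determined by the roots of
the characteristic polynomial. -/
lemma IsHermitian.sum_eigenvalues_eq_sum_roots {A : Matrix n n ℂ} (hA : A.IsHermitian)
    (f : ℝ → ℝ) :
    ∑ i, f (hA.eigenvalues i) = (A.charpoly.roots.map fun z ↦ f z.re).sum := by
  rw [hA.roots_charpoly_eq_eigenvalues, Multiset.map_map]
  rfl

open Polynomial in
lemma IsHermitian.roots_charpoly_mul_self {A : Matrix n n ℂ} (hA : A.IsHermitian) :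
    (A * A).charpoly.roots =
      Multiset.map (fun i ↦ ((hA.eigenvalues i ^ 2 : ℝ) : ℂ)) Finset.univ.val := by
  have h : (A * A).charpoly = ∏ i, (X - C ((hA.eigenvalues i ^ 2 : ℝ) : ℂ)) := by
    conv_lhs => rw [hA.spectral_theorem, ← map_mul, Unitary.conjStarAlgAut_apply,
      charpoly_mul_comm, ← mul_assoc]
    simp [charpoly_diagonal, pow_two]
  rw [h, Polynomial.roots_prod]
  · simp only [roots_X_sub_C, Multiset.bind_singleton]
  · exact Finset.prod_ne_zero_iff.mpr fun i _ ↦ X_sub_C_ne_zero _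

open Polynomial in
/-- `M * N` and `N * M` have the same nonzero eigenvalues with multiplicity. -/
lemma sum_roots_charpoly_mul_comm (M : Matrix m n ℂ) (N : Matrix n m ℂ) {f : ℂ → ℝ}
    (hf : f 0 = 0) :
    ((M * N).charpoly.roots.map f).sum = ((N * M).charpoly.roots.map f).sum := by
  have h := congrArg (fun p : ℂ[X] ↦ (p.roots.map f).sum) (charpoly_mul_comm' M N)
  have hne (k : ℕ) {p : ℂ[X]} (hp : p.Monic) : X ^ k * p ≠ 0 :=
    ((monic_X_pow k).mul hp).ne_zero
  simpa [roots_mul (hne _ (charpoly_monic _)), Multiset.map_nsmul, Multiset.sum_nsmul, hf] using h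

lemma sum_row_normSq_of_mem_unitaryGroup {W : Matrix n n ℂ} (hW : W ∈ unitaryGroup n ℂ) (i : n) :
    ∑ j, Complex.normSq (W i j) = 1 := by
  have h := congrFun₂ (mem_unitaryGroup_iff.mp hW) i i
  rw [mul_apply, one_apply_eq] at h
  have h' : ((∑ j, Complex.normSq (W i j) : ℝ) : ℂ) = 1 := by
    rw [← h]
    push_cast
    exact Finset.sum_congr rfl fun j _ ↦ (Complex.mul_conj (W i j)).symm
  exact_mod_cast h'

lemma sum_col_normSq_of_mem_unitaryGroup {W : Matrix n n ℂ} (hW : W ∈ unitaryGroup n ℂ) (j : n) :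
    ∑ i, Complex.normSq (W i j) = 1 := by
  have h := sum_row_normSq_of_mem_unitaryGroup (Unitary.star_mem hW) j
  simpa [star_apply] using h

/-- Schur: in any orthonormal basis, the `q`-th powers of the diagonal of a positive semidefinite
matrix sum to at most the `q`-th powers of its eigenvalues. -/
lemma PosSemidef.sum_diag_rpow_le {A : Matrix n n ℂ} (hA : A.PosSemidef) {q : ℝ} (hq : 1 ≤ q)
    {U : Matrix n n ℂ} (hU : U ∈ unitaryGroup n ℂ) :
    ∑ i, ((star U * A * U) i i).re ^ q ≤ ∑ i, hA.1.eigenvalues i ^ q := by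
  set V : Matrix n n ℂ := hA.1.eigenvectorUnitary.1 with hV
  set W : Matrix n n ℂ := star V * U with hWdef
  have hW : W ∈ unitaryGroup n ℂ :=
    mul_mem (Unitary.star_mem hA.1.eigenvectorUnitary.2) hU
  have hdiag (i : n) : ((star U * A * U) i i).re =
      ∑ j, Complex.normSq (W j i) • hA.1.eigenvalues j := by
    have h : star U * A * U = star W * diagonal (RCLike.ofReal ∘ hA.1.eigenvalues) * W := by
      conv_lhs => rw [hA.1.spectral_theorem, Unitary.conjStarAlgAut_apply]
      simp only [hWdef, star_mul, star_star, mul_assoc, hV]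
    rw [h, mul_apply, Complex.re_sum]
    refine Finset.sum_congr rfl fun j _ ↦ ?_
    rw [mul_diagonal, star_apply]
    simp [Complex.normSq_apply]
    ring
  calc ∑ i, ((star U * A * U) i i).re ^ q
      ≤ ∑ i, ∑ j, Complex.normSq (W j i) • hA.1.eigenvalues j ^ q := by
        refine Finset.sum_le_sum fun i _ ↦ ?_
        rw [hdiag]
        exact (convexOn_rpow hq).map_sum_le (fun j _ ↦ Complex.normSq_nonneg _)
          (sum_col_normSq_of_mem_unitaryGroup hW i) fun j _ ↦ hA.eigenvalues_nonneg j
    _ = ∑ j, hA.1.eigenvalues j ^ q := by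
        rw [Finset.sum_comm]
        refine Finset.sum_congr rfl fun j _ ↦ ?_
        rw [← Finset.sum_smul, sum_row_normSq_of_mem_unitaryGroup hW, one_smul]

/-- Minkowski's inequality for the eigenvalues of positive semidefinite matrices. -/
lemma PosSemidef.Lp_eigenvalues_add_le {P Q : Matrix n n ℂ} (hP : P.PosSemidef)
    (hQ : Q.PosSemidef) {q : ℝ} (hq : 1 ≤ q) :
    (∑ i, (hP.add hQ).1.eigenvalues i ^ q) ^ (1 / q) ≤
      (∑ i, hP.1.eigenvalues i ^ q) ^ (1 / q) + (∑ i, hQ.1.eigenvalues i ^ q) ^ (1 / q) := by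
  set U := (hP.add hQ).1.eigenvectorUnitary with hU
  have hnn {A : Matrix n n ℂ} (hA : A.PosSemidef) (i : n) :
      0 ≤ ((star (U : Matrix n n ℂ) * A * U) i i).re :=
    (Complex.le_def.mp (hA.conjTranspose_mul_mul_same (U : Matrix n n ℂ)).diag_nonneg).1
  have heig (i : n) : (hP.add hQ).1.eigenvalues i =
      ((star (U : Matrix n n ℂ) * P * U) i i).re + ((star (U : Matrix n n ℂ) * Q * U) i i).re := by
    have h := congrFun₂ (hP.add hQ).1.conjStarAlgAut_star_eigenvectorUnitary i i
    rw [Unitary.conjStarAlgAut_star_apply, ← hU, mul_add, add_mul, diagonal_apply_eq] at h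
    simpa using (congrArg Complex.re h).symm
  simp_rw [heig]
  refine (Real.Lp_add_le_of_nonneg Finset.univ hq (fun i _ ↦ hnn hP i)
    (fun i _ ↦ hnn hQ i)).trans ?_
  gcongr ?_ ^ _ + ?_ ^ _
  · exact Finset.sum_nonneg fun i _ ↦ Real.rpow_nonneg (hnn hP i) q
  · exact hP.sum_diag_rpow_le hq U.2
  · exact Finset.sum_nonneg fun i _ ↦ Real.rpow_nonneg (hnn hQ i) q
  · exact hQ.sum_diag_rpow_le hq U.2

end Matrix

/-- The Schatten norm of a positive semidefinite matrix is the `ℓ_q` norm of its eigenvalues. -/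
lemma Matrix.PosSemidef.schattenNorm_eq {n : Type*} [Fintype n] [DecidableEq n]
    {A : Matrix n n ℂ} (hA : A.PosSemidef) (q : ℝ) :
    schattenNorm q A = (∑ i, hA.1.eigenvalues i ^ q) ^ (1 / q) := by
  unfold schattenNorm
  rw [Matrix.IsHermitian.sum_eigenvalues_eq_sum_roots _ (fun x ↦ x ^ (q / 2)), hA.1.eq,
    hA.1.roots_charpoly_mul_self, Multiset.map_map]
  congr 1
  refine Finset.sum_congr rfl fun i _ ↦ ?_
  simp only [Function.comp_apply, Complex.ofReal_re]
  rw [← Real.rpow_natCast, ← Real.rpow_mul (hA.eigenvalues_nonneg i)]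
  congr 1
  push_cast
  ring

lemma schattenNorm_conjTranspose_mul_self {m n : Type*} [Fintype m] [Fintype n] [DecidableEq m]
    [DecidableEq n] {q : ℝ} (hq : q ≠ 0) (X : Matrix m n ℂ) :
    schattenNorm q (Xᴴ * X) = schattenNorm q (X * Xᴴ) := by
  rw [(posSemidef_conjTranspose_mul_self X).schattenNorm_eq,
    (posSemidef_self_mul_conjTranspose X).schattenNorm_eq,
    IsHermitian.sum_eigenvalues_eq_sum_roots _ (fun x ↦ x ^ q),
    IsHermitian.sum_eigenvalues_eq_sum_roots _ (fun x ↦ x ^ q),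
    sum_roots_charpoly_mul_comm]
  simp [Real.zero_rpow hq]

lemma Matrix.PosSemidef.schattenNorm_add_le {n : Type*} [Fintype n] [DecidableEq n]
    {P Q : Matrix n n ℂ} (hP : P.PosSemidef) (hQ : Q.PosSemidef) {q : ℝ} (hq : 1 ≤ q) :
    schattenNorm q (P + Q) ≤ schattenNorm q P + schattenNorm q Q := by
  rw [hP.schattenNorm_eq, hQ.schattenNorm_eq, (hP.add hQ).schattenNorm_eq]
  exact hP.Lp_eigenvalues_add_le hQ hq

/-- For a positive semidefinite block matrix `ρ = [[B, C],[C†, D]]` and `q ≥ 1`,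
`‖ρ‖_q ≤ ‖B‖_q + ‖D‖_q`. -/
theorem schatten_fromBlocks_le (d₁ d₂ : ℕ) (q : ℝ) (hq : 1 ≤ q)
    (B : Matrix (Fin d₁) (Fin d₁) ℂ) (D : Matrix (Fin d₂) (Fin d₂) ℂ)
    (C : Matrix (Fin d₁) (Fin d₂) ℂ)
    (hρ : (Matrix.fromBlocks B C Cᴴ D).PosSemidef) :
    schattenNorm q (Matrix.fromBlocks B C Cᴴ D) ≤ schattenNorm q B + schattenNorm q D := by
  have hq0 : q ≠ 0 := by positivity
  obtain ⟨X, hX⟩ : ∃ X : Matrix (Fin d₁ ⊕ Fin d₂) (Fin d₁ ⊕ Fin d₂) ℂ,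
      fromBlocks B C Cᴴ D = Xᴴ * X := by
    open scoped MatrixOrder in
    exact CStarAlgebra.nonneg_iff_eq_star_mul_self.mp hρ.nonneg
  obtain ⟨Y, Z, rfl⟩ : ∃ Y Z, X = fromCols Y Z := ⟨X.toCols₁, X.toCols₂, by simp⟩
  rw [hX, schattenNorm_conjTranspose_mul_self hq0]
  rw [conjTranspose_fromCols_eq_fromRows_conjTranspose, fromRows_mul_fromCols,
    fromBlocks_inj] at hX
  rw [conjTranspose_fromCols_eq_fromRows_conjTranspose, fromCols_mul_fromRows, hX.1, hX.2.2.2,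
    schattenNorm_conjTranspose_mul_self hq0 Y, schattenNorm_conjTranspose_mul_self hq0 Z]
  exact (posSemidef_self_mul_conjTranspose Y).schattenNorm_add_le
    (posSemidef_self_mul_conjTranspose Z) hq
end

section
/- Let F be an n×m complex matrix, H an m×m complex matrix, and q ≥ 1. Then Tr |F H F†|^q ≤ Tr[ (F†F)^q · (|H|^q + |H†|^q)/2 ], where |X| := (X†X)^{1/2} denotes the operator absolute value. -/
open scoped Kronecker ComplexOrder
open Matrix

/-- The real power `M^q` of a Hermitian matrix `M`, defined via the spectral decomposition. -/
noncomputable def hermitianRpow {n : Type*} [Fintype n] [DecidableEq n]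
    (M : Matrix n n ℂ) (hM : M.IsHermitian) (q : ℝ) : Matrix n n ℂ :=
  (hM.eigenvectorUnitary : Matrix n n ℂ) *
    Matrix.diagonal (fun i => ((hM.eigenvalues i ^ q : ℝ) : ℂ)) *
    (hM.eigenvectorUnitary : Matrix n n ℂ)ᴴ

/-- `|M|^q := (M† M)^{q/2}`, the `q`-th power of the absolute value of a matrix. -/
noncomputable def absRpow {m n : Type*} [Fintype m] [Fintype n] [DecidableEq n]
    (M : Matrix m n ℂ) (q : ℝ) : Matrix n n ℂ :=
  hermitianRpow (Mᴴ * M) (Matrix.posSemidef_conjTranspose_mul_self M).1 (q / 2)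

open Complex

/-- The exponential family `exp (s log x)`, extended by `0` at `x = 0`. -/
noncomputable def suppExp (x : ℝ) (s : ℂ) : ℂ :=
  if x = 0 then 0 else Complex.exp (s * (Real.log x : ℂ))

lemma suppExp_mul (x : ℝ) (s t : ℂ) : suppExp x s * suppExp x t = suppExp x (s + t) := by
  unfold suppExp
  split_ifs
  · simp
  · rw [← Complex.exp_add, add_mul]

lemma star_suppExp (x : ℝ) (s : ℂ) : star (suppExp x s) = suppExp x (star s) := by
  unfold suppExp
  split_ifs
  · simp
  · simp [← Complex.exp_conj]

lemma suppExp_ofReal {x : ℝ} (hx : 0 ≤ x) {r : ℝ} (hr : 0 < r) :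
    suppExp x r = ((x ^ r : ℝ) : ℂ) := by
  unfold suppExp
  split_ifs with h
  · simp [h, Real.zero_rpow hr.ne']
  · rw [Real.rpow_def_of_pos (lt_of_le_of_ne hx (Ne.symm h)), mul_comm]
    push_cast
    rfl

lemma norm_suppExp_le_one (x : ℝ) {s : ℂ} (hs : s.re = 0) : ‖suppExp x s‖ ≤ 1 := by
  unfold suppExp
  split_ifs
  · simp
  · simp [Complex.norm_exp, hs]

/-- Complex powers of a Hermitian matrix, vanishing on its kernel. -/
noncomputable def hermitianCpow {n : Type*} [Fintype n] [DecidableEq n]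
    (M : Matrix n n ℂ) (hM : M.IsHermitian) (s : ℂ) : Matrix n n ℂ :=
  (hM.eigenvectorUnitary : Matrix n n ℂ) *
    Matrix.diagonal (fun i => suppExp (hM.eigenvalues i) s) *
    (hM.eigenvectorUnitary : Matrix n n ℂ)ᴴ

section hermitianCpow

variable {m n : Type*} [Fintype m] [Fintype n] [DecidableEq n]

lemma conjTranspose_mul_eigenvectorUnitary {M : Matrix n n ℂ} (hM : M.IsHermitian) :
    (hM.eigenvectorUnitary : Matrix n n ℂ)ᴴ * (hM.eigenvectorUnitary : Matrix n n ℂ) = 1 :=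
  Matrix.UnitaryGroup.star_mul_self hM.eigenvectorUnitary

lemma eigenvectorUnitary_mul_conjTranspose {M : Matrix n n ℂ} (hM : M.IsHermitian) :
    (hM.eigenvectorUnitary : Matrix n n ℂ) * (hM.eigenvectorUnitary : Matrix n n ℂ)ᴴ = 1 :=
  mul_eq_one_comm.mp (conjTranspose_mul_eigenvectorUnitary hM)

lemma eq_eigenvectorUnitary_mul_diagonal {M : Matrix n n ℂ} (hM : M.IsHermitian) :
    M = (hM.eigenvectorUnitary : Matrix n n ℂ) *
      Matrix.diagonal (fun i => (hM.eigenvalues i : ℂ)) *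
      (hM.eigenvectorUnitary : Matrix n n ℂ)ᴴ := by
  conv_lhs => rw [hM.spectral_theorem, Unitary.conjStarAlgAut_apply]
  rfl

lemma hermitianCpow_mul {M : Matrix n n ℂ} (hM : M.IsHermitian) (s t : ℂ) :
    hermitianCpow M hM s * hermitianCpow M hM t = hermitianCpow M hM (s + t) := by
  unfold hermitianCpow
  simp only [← suppExp_mul, ← Matrix.diagonal_mul_diagonal]
  simp only [Matrix.mul_assoc]
  rw [← Matrix.mul_assoc _ᴴ, conjTranspose_mul_eigenvectorUnitary, Matrix.one_mul]

lemma conjTranspose_hermitianCpow {M : Matrix n n ℂ} (hM : M.IsHermitian) (s : ℂ) :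
    (hermitianCpow M hM s)ᴴ = hermitianCpow M hM (star s) := by
  unfold hermitianCpow
  simp only [Matrix.conjTranspose_mul, Matrix.conjTranspose_conjTranspose,
    Matrix.diagonal_conjTranspose, Matrix.mul_assoc]
  simp only [Pi.star_def, star_suppExp]

lemma hermitianRpow_eq_hermitianCpow {M : Matrix n n ℂ} (hM : M.PosSemidef) {r : ℝ} (hr : 0 < r) :
    hermitianRpow M hM.1 r = hermitianCpow M hM.1 r := by
  unfold hermitianRpow hermitianCpow
  simp only [suppExp_ofReal (hM.eigenvalues_nonneg _) hr]

lemma hermitianCpow_one {M : Matrix n n ℂ} (hM : M.PosSemidef) : hermitianCpow M hM.1 1 = M := by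
  conv_rhs => rw [eq_eigenvectorUnitary_mul_diagonal hM.1]
  unfold hermitianCpow
  have h i := suppExp_ofReal (hM.eigenvalues_nonneg i) one_pos
  simp only [Complex.ofReal_one, Real.rpow_one] at h
  simp only [h]

/-- A matrix intertwining two Hermitian matrices intertwines their complex powers. -/
lemma hermitianCpow_mul_eq_mul_hermitianCpow [DecidableEq m] {M : Matrix m m ℂ} {N : Matrix n n ℂ}
    (hM : M.IsHermitian) (hN : N.IsHermitian) {X : Matrix m n ℂ} (h : M * X = X * N) (s : ℂ) :
    hermitianCpow M hM s * X = X * hermitianCpow N hN s := by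
  set U := (hM.eigenvectorUnitary : Matrix m m ℂ) with hU
  set V := (hN.eigenvectorUnitary : Matrix n n ℂ) with hV
  have hUU : Uᴴ * U = 1 := conjTranspose_mul_eigenvectorUnitary hM
  have hUU' : U * Uᴴ = 1 := eigenvectorUnitary_mul_conjTranspose hM
  have hVV : Vᴴ * V = 1 := conjTranspose_mul_eigenvectorUnitary hN
  have hVV' : V * Vᴴ = 1 := eigenvectorUnitary_mul_conjTranspose hN
  set Y := Uᴴ * X * V with hY
  have hX : X = U * Y * Vᴴ := by
    rw [hY]
    calc X = (U * Uᴴ) * X * (V * Vᴴ) := by rw [hUU', hVV', Matrix.one_mul, Matrix.mul_one]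
      _ = _ := by simp only [Matrix.mul_assoc]
  have key : Matrix.diagonal (fun i => (hM.eigenvalues i : ℂ)) * Y =
      Y * Matrix.diagonal (fun i => (hN.eigenvalues i : ℂ)) := by
    have h1 : Uᴴ * (M * X) * V = Uᴴ * (X * N) * V := by rw [h]
    rw [eq_eigenvectorUnitary_mul_diagonal hM, eq_eigenvectorUnitary_mul_diagonal hN, ← hU,
      ← hV] at h1
    calc _ = (Uᴴ * U) * Matrix.diagonal (fun i => (hM.eigenvalues i : ℂ)) * Y := by
          rw [hUU, Matrix.one_mul]
      _ = Uᴴ * (U * Matrix.diagonal (fun i => (hM.eigenvalues i : ℂ)) * Uᴴ * X) * V := by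
          simp only [hY, Matrix.mul_assoc]
      _ = Y * Matrix.diagonal (fun i => (hN.eigenvalues i : ℂ)) * (Vᴴ * V) := by
          rw [h1]; simp only [hY, Matrix.mul_assoc]
      _ = _ := by rw [hVV, Matrix.mul_one]
  have key' : Matrix.diagonal (fun i => suppExp (hM.eigenvalues i) s) * Y =
      Y * Matrix.diagonal (fun i => suppExp (hN.eigenvalues i) s) := by
    ext i j
    have hij := congrFun (congrFun key i) j
    simp only [Matrix.diagonal_mul, Matrix.mul_diagonal] at hij ⊢
    by_cases h0 : Y i j = 0
    · simp [h0]
    · rw [mul_comm, mul_right_inj' h0, Complex.ofReal_inj] at hij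
      rw [hij, mul_comm]
  unfold hermitianCpow
  rw [← hU, ← hV, hX]
  calc _ = U * (Matrix.diagonal (fun i => suppExp (hM.eigenvalues i) s) * ((Uᴴ * U) * Y)) * Vᴴ := by
        simp only [Matrix.mul_assoc]
    _ = U * (Y * (Vᴴ * V) * Matrix.diagonal (fun i => suppExp (hN.eigenvalues i) s)) * Vᴴ := by
        rw [hUU, hVV, Matrix.one_mul, Matrix.mul_one, key']
    _ = _ := by simp only [Matrix.mul_assoc]

lemma mul_hermitianCpow_zero (X : Matrix m n ℂ) :
    X * hermitianCpow (Xᴴ * X) (posSemidef_conjTranspose_mul_self X).1 0 = X := by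
  set hM := posSemidef_conjTranspose_mul_self X
  set E := hermitianCpow (Xᴴ * X) hM.1 0 with hE
  have hEX : Xᴴ * X * E = Xᴴ * X := by
    have := hermitianCpow_mul hM.1 1 0
    rwa [add_zero, hermitianCpow_one hM] at this
  have h : (X * E - X)ᴴ * (X * E - X) = 0 := by
    rw [Matrix.conjTranspose_sub, Matrix.mul_sub, Matrix.sub_mul, Matrix.sub_mul,
      Matrix.conjTranspose_mul]
    simp only [Matrix.mul_assoc] at hEX ⊢
    simp [hEX]
  exact sub_eq_zero.mp (Matrix.conjTranspose_mul_self_eq_zero.mp h)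

open scoped Matrix.Norms.L2Operator

lemma norm_hermitianCpow_le_one {M : Matrix n n ℂ} (hM : M.IsHermitian) {s : ℂ} (hs : s.re = 0) :
    ‖hermitianCpow M hM s‖ ≤ 1 := by
  have hU : ‖(hM.eigenvectorUnitary : Matrix n n ℂ)‖ ≤ 1 := by
    have h := Matrix.l2_opNorm_conjTranspose_mul_self (hM.eigenvectorUnitary : Matrix n n ℂ)
    rw [conjTranspose_mul_eigenvectorUnitary, ← Matrix.diagonal_one,
      Matrix.l2_opNorm_diagonal] at h
    have h1 : ‖(1 : n → ℂ)‖ ≤ 1 := (pi_norm_le_iff_of_nonneg zero_le_one).2 (by simp)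
    have h2 : ‖(hM.eigenvectorUnitary : Matrix n n ℂ)‖ * ‖(hM.eigenvectorUnitary : Matrix n n ℂ)‖
      ≤ 1 := h ▸ h1
    nlinarith [norm_nonneg (hM.eigenvectorUnitary : Matrix n n ℂ)]
  have hD : ‖Matrix.diagonal (fun i => suppExp (hM.eigenvalues i) s)‖ ≤ 1 := by
    rw [Matrix.l2_opNorm_diagonal, pi_norm_le_iff_of_nonneg zero_le_one]
    exact fun i => norm_suppExp_le_one _ hs
  unfold hermitianCpow
  calc _ ≤ _ := Matrix.l2_opNorm_mul _ _
    _ ≤ 1 * 1 := by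
      gcongr
      · exact (Matrix.l2_opNorm_mul _ _).trans (mul_le_one₀ hU (norm_nonneg _) hD)
      · rwa [Matrix.l2_opNorm_conjTranspose]
    _ = 1 := one_mul 1

lemma norm_mul_hermitianCpow_le_one (X : Matrix m n ℂ) {s : ℂ} (hs : s.re = -1 / 2) :
    ‖X * hermitianCpow (Xᴴ * X) (posSemidef_conjTranspose_mul_self X).1 s‖ ≤ 1 := by
  set hM := posSemidef_conjTranspose_mul_self X
  have h := Matrix.l2_opNorm_conjTranspose_mul_self (X * hermitianCpow (Xᴴ * X) hM.1 s)
  have h2 : (X * hermitianCpow (Xᴴ * X) hM.1 s)ᴴ * (X * hermitianCpow (Xᴴ * X) hM.1 s) =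
      hermitianCpow (Xᴴ * X) hM.1 (star s + 1 + s) := by
    rw [← hermitianCpow_mul, ← hermitianCpow_mul, hermitianCpow_one hM, Matrix.conjTranspose_mul,
      conjTranspose_hermitianCpow]
    simp only [Matrix.mul_assoc]
  have h3 := norm_hermitianCpow_le_one hM.1 (s := star s + 1 + s) (by simp [hs]; norm_num)
  rw [← h2, h] at h3
  nlinarith [norm_nonneg (X * hermitianCpow (Xᴴ * X) hM.1 s)]

lemma norm_mul_le_one_of_le_one {l : Type*} [Fintype l] [DecidableEq l]
    {A : Matrix m n ℂ} {B : Matrix n l ℂ}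
    (hA : ‖A‖ ≤ 1) (hB : ‖B‖ ≤ 1) : ‖A * B‖ ≤ 1 :=
  (Matrix.l2_opNorm_mul A B).trans (mul_le_one₀ hA (norm_nonneg _) hB)

lemma trace_conjTranspose_mul_self_eq_sum {m n : Type*} [Fintype m] [Fintype n] (X : Matrix m n ℂ) :
    (Xᴴ * X).trace = ((∑ j, ∑ i, ‖X i j‖ ^ 2 : ℝ) : ℂ) := by
  simp [Matrix.trace, Matrix.mul_apply, Complex.conj_mul']

lemma sum_norm_sq_mul_le {l : Type*} [Fintype l] [DecidableEq l]
    {C : Matrix m n ℂ} (hC : ‖C‖ ≤ 1) (X : Matrix n l ℂ) :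
    ∑ j, ∑ i, ‖(C * X) i j‖ ^ 2 ≤ ∑ j, ∑ i, ‖X i j‖ ^ 2 := by
  refine Finset.sum_le_sum fun j _ => ?_
  have h := C.l2_opNorm_mulVec (WithLp.toLp 2 fun i => X i j)
  have h' := h.trans (mul_le_of_le_one_left (norm_nonneg _) hC)
  have h2 := pow_le_pow_left₀ (norm_nonneg _) h' 2
  rw [EuclideanSpace.norm_sq_eq, EuclideanSpace.norm_sq_eq] at h2
  simpa [Matrix.mul_apply, Matrix.mulVec, dotProduct] using h2

/-- Cauchy–Schwarz for the trace, with a contraction inserted. -/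
lemma norm_trace_mul_mul_le {l : Type*} [Fintype l] [DecidableEq l]
    {C : Matrix m n ℂ} (hC : ‖C‖ ≤ 1) (X : Matrix n l ℂ) (Y : Matrix l m ℂ) :
    ‖(C * X * Y).trace‖ ≤ ((X * Xᴴ).trace.re + (Yᴴ * Y).trace.re) / 2 := by
  have h := sum_norm_sq_mul_le hC X
  rw [Matrix.trace_mul_comm X, trace_conjTranspose_mul_self_eq_sum,
    trace_conjTranspose_mul_self_eq_sum, Complex.ofReal_re, Complex.ofReal_re]
  calc ‖(C * X * Y).trace‖ = ‖∑ i, ∑ j, (C * X) i j * Y j i‖ := by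
        simp only [Matrix.trace, Matrix.diag, Matrix.mul_apply (M := C * X)]
    _ ≤ ∑ i, ∑ j, ‖(C * X) i j * Y j i‖ :=
        (norm_sum_le _ _).trans (Finset.sum_le_sum fun i _ => norm_sum_le _ _)
    _ ≤ ∑ i, ∑ j, (‖(C * X) i j‖ ^ 2 / 2 + ‖Y j i‖ ^ 2 / 2) := by
        gcongr with i _ j _
        rw [norm_mul]
        nlinarith [sq_nonneg (‖(C * X) i j‖ - ‖Y j i‖)]
    _ = ((∑ j, ∑ i, ‖(C * X) i j‖ ^ 2) + ∑ i, ∑ j, ‖Y j i‖ ^ 2) / 2 := by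
        simp only [Finset.sum_add_distrib, ← Finset.sum_div]
        rw [Finset.sum_comm (f := fun i j => ‖(C * X) i j‖ ^ 2)]
        ring
    _ ≤ _ := by gcongr

end hermitianCpow

/-- Entire functions that are bounded on the closed strip `0 ≤ re z ≤ 1`. -/
def EntireBddOnStrip (f : ℂ → ℂ) : Prop :=
  Differentiable ℂ f ∧ ∃ B : ℝ, ∀ z : ℂ, 0 ≤ z.re → z.re ≤ 1 → ‖f z‖ ≤ B

namespace EntireBddOnStrip

lemma const (c : ℂ) : EntireBddOnStrip fun _ => c :=
  ⟨differentiable_const c, ‖c‖, fun _ _ _ => le_rfl⟩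

lemma mul {f g : ℂ → ℂ} (hf : EntireBddOnStrip f) (hg : EntireBddOnStrip g) :
    EntireBddOnStrip fun z => f z * g z := by
  obtain ⟨hf, A, hA⟩ := hf
  obtain ⟨hg, B, hB⟩ := hg
  refine ⟨hf.mul hg, A * B, fun z h0 h1 => ?_⟩
  rw [norm_mul]
  exact mul_le_mul (hA z h0 h1) (hB z h0 h1) (norm_nonneg _) ((norm_nonneg _).trans (hA z h0 h1))

lemma sum {ι : Type*} (s : Finset ι) {f : ι → ℂ → ℂ} (hf : ∀ i, EntireBddOnStrip (f i)) :
    EntireBddOnStrip fun z => ∑ i ∈ s, f i z := by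
  choose hd B hB using hf
  exact ⟨Differentiable.fun_sum fun i _ => hd i, ∑ i ∈ s, B i, fun z h0 h1 =>
    (norm_sum_le _ _).trans (Finset.sum_le_sum fun i _ => hB i z h0 h1)⟩

lemma matrix_mul {l m n : Type*} [Fintype m] {A : ℂ → Matrix l m ℂ} {B : ℂ → Matrix m n ℂ}
    (hA : ∀ i j, EntireBddOnStrip fun z => A z i j)
    (hB : ∀ i j, EntireBddOnStrip fun z => B z i j) (i : l) (j : n) :
    EntireBddOnStrip fun z => (A z * B z) i j := by
  simp only [Matrix.mul_apply]
  exact sum _ fun k => (hA i k).mul (hB k j)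

lemma suppExp (x a b : ℝ) : EntireBddOnStrip fun z => suppExp x (a * z + b) := by
  unfold _root_.suppExp
  split_ifs
  · exact const 0
  · refine ⟨by fun_prop, Real.exp ((|a| + |b|) * |Real.log x|), fun z h0 h1 => ?_⟩
    rw [Complex.norm_exp, Real.exp_le_exp]
    have h : ((a * z + b) * (Real.log x : ℂ)).re = (a * z.re + b) * Real.log x := by
      simp
    rw [h]
    refine (le_abs_self _).trans ?_
    rw [abs_mul]
    gcongr
    refine (abs_add_le _ _).trans (add_le_add_left ?_ _)
    rw [abs_mul, abs_of_nonneg h0]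
    exact mul_le_of_le_one_right (abs_nonneg a) h1

lemma hermitianCpow {n : Type*} [Fintype n] [DecidableEq n] {M : Matrix n n ℂ}
    (hM : M.IsHermitian) (a b : ℝ) (i j : n) :
    EntireBddOnStrip fun z => hermitianCpow M hM (a * z + b) i j := by
  unfold _root_.hermitianCpow
  have hD (k l : n) : EntireBddOnStrip fun z : ℂ =>
      Matrix.diagonal (fun i => _root_.suppExp (hM.eigenvalues i) (a * z + b)) k l := by
    by_cases h : k = l
    · subst h
      simpa only [Matrix.diagonal_apply_eq] using suppExp _ a b
    · simpa only [Matrix.diagonal_apply_ne _ h] using const 0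
  have hU := matrix_mul (A := fun _ => (hM.eigenvectorUnitary : Matrix n n ℂ))
    (fun k l => const _) hD
  exact matrix_mul hU (B := fun _ => (hM.eigenvectorUnitary : Matrix n n ℂ)ᴴ)
    (fun k l => const _) i j

end EntireBddOnStrip

section

open scoped Matrix.Norms.L2Operator

variable {m n : Type*} [Fintype m] [Fintype n] [DecidableEq n]

lemma absRpow_eq_hermitianCpow (X : Matrix m n ℂ) {q : ℝ} (hq : 0 < q) :
    absRpow X q =
      hermitianCpow (Xᴴ * X) (posSemidef_conjTranspose_mul_self X).1 ((q : ℂ) / 2) := by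
  rw [absRpow, hermitianRpow_eq_hermitianCpow (posSemidef_conjTranspose_mul_self X) (half_pos hq)]
  push_cast
  rfl

lemma mul_hermitianCpow_mul_conjTranspose [DecidableEq m] (X : Matrix m n ℂ) (s : ℂ) :
    X * hermitianCpow (Xᴴ * X) (posSemidef_conjTranspose_mul_self X).1 s * Xᴴ =
      hermitianCpow (Xᴴᴴ * Xᴴ) (posSemidef_conjTranspose_mul_self Xᴴ).1 (s + 1) := by
  rw [← hermitianCpow_mul_eq_mul_hermitianCpow (posSemidef_conjTranspose_mul_self Xᴴ).1
    (posSemidef_conjTranspose_mul_self X).1 (by simp [Matrix.mul_assoc]), ← hermitianCpow_mul,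
    hermitianCpow_one (posSemidef_conjTranspose_mul_self Xᴴ), Matrix.mul_assoc]
  congr 2
  exact (Matrix.conjTranspose_conjTranspose X).symm

/-- The trace of `A^s N A^{s̄}` depends only on `re s`. -/
lemma trace_hermitianCpow_conj {M : Matrix n n ℂ} (hM : M.IsHermitian) (N : Matrix n n ℂ)
    {q : ℝ} {s : ℂ} (hs : s.re = q / 2) :
    (hermitianCpow M hM s * N * hermitianCpow M hM (star s)).trace =
      (hermitianCpow M hM q * N).trace := by
  rw [Matrix.trace_mul_comm, ← Matrix.mul_assoc, hermitianCpow_mul]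
  congr 3
  apply Complex.ext
  · simp [hs]
  · simp

/-- The function to which the three lines theorem is applied. -/
noncomputable def threeLinesFun [DecidableEq m] (K : Matrix n n ℂ) (F : Matrix n m ℂ)
    (H : Matrix m m ℂ) (q : ℝ) (z : ℂ) : ℂ :=
  (hermitianCpow (Kᴴ * K) (posSemidef_conjTranspose_mul_self K).1 ((q - 1 - q * z) / 2) * Kᴴ *
    (F * hermitianCpow (Fᴴ * F) (posSemidef_conjTranspose_mul_self F).1 ((q * z - 1) / 2)) *
    (H * hermitianCpow (Hᴴ * H) (posSemidef_conjTranspose_mul_self H).1 ((q * z - 1) / 2)) *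
    (hermitianCpow (Fᴴ * F) (posSemidef_conjTranspose_mul_self F).1 ((q * z - 1) / 2) *
      Fᴴ)).trace

lemma entireBddOnStrip_threeLinesFun [DecidableEq m] (K : Matrix n n ℂ) (F : Matrix n m ℂ)
    (H : Matrix m m ℂ) (q : ℝ) :
    EntireBddOnStrip (threeLinesFun K F H q) := by
  have h1 (z : ℂ) : (q - 1 - q * z) / 2 = ((-q / 2 : ℝ) : ℂ) * z + (((q - 1) / 2 : ℝ) : ℂ) := by
    push_cast; ring
  have h2 (z : ℂ) : (q * z - 1) / 2 = ((q / 2 : ℝ) : ℂ) * z + ((-1 / 2 : ℝ) : ℂ) := by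
    push_cast; ring
  unfold threeLinesFun
  simp only [h1, h2, Matrix.trace, Matrix.diag]
  refine .sum _ fun i => ?_
  have hA := EntireBddOnStrip.hermitianCpow
    (posSemidef_conjTranspose_mul_self F).1 (q / 2) (-1 / 2)
  have hL := EntireBddOnStrip.hermitianCpow
    (posSemidef_conjTranspose_mul_self H).1 (q / 2) (-1 / 2)
  have hT := EntireBddOnStrip.hermitianCpow
    (posSemidef_conjTranspose_mul_self K).1 (-q / 2) ((q - 1) / 2)
  have t1 := EntireBddOnStrip.matrix_mul hT (B := fun _ => Kᴴ) fun k l => .const _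
  have t2 := EntireBddOnStrip.matrix_mul (A := fun _ => F) (fun k l => .const _) hA
  have t3 := EntireBddOnStrip.matrix_mul (A := fun _ => H) (fun k l => .const _) hL
  have t4 := EntireBddOnStrip.matrix_mul hA (B := fun _ => Fᴴ) fun k l => .const _
  exact EntireBddOnStrip.matrix_mul (EntireBddOnStrip.matrix_mul
    (EntireBddOnStrip.matrix_mul t1 t2) t3) t4 i i

lemma threeLinesFun_inv [DecidableEq m] (F : Matrix n m ℂ) (H : Matrix m m ℂ) {q : ℝ} (hq : 0 < q) :
    threeLinesFun (F * H * Fᴴ) F H q ((q⁻¹ : ℝ) : ℂ) = (absRpow (F * H * Fᴴ) q).trace := by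
  have hq' : (q : ℂ) ≠ 0 := by exact_mod_cast hq.ne'
  have e1 : ((q : ℂ) - 1 - q * ((q⁻¹ : ℝ) : ℂ)) / 2 = q / 2 - 1 := by
    push_cast; field_simp; ring
  have e2 : ((q : ℂ) * ((q⁻¹ : ℝ) : ℂ) - 1) / 2 = 0 := by
    push_cast; field_simp; ring
  have hF := mul_hermitianCpow_zero F
  have hF' := congrArg Matrix.conjTranspose hF
  rw [Matrix.conjTranspose_mul, conjTranspose_hermitianCpow, star_zero] at hF'
  unfold threeLinesFun
  simp only [e1, e2]
  rw [hF, mul_hermitianCpow_zero, hF', absRpow_eq_hermitianCpow _ hq]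
  set K := F * H * Fᴴ with hK
  have hT := hermitianCpow_mul (posSemidef_conjTranspose_mul_self K).1 ((q : ℂ) / 2 - 1) 1
  rw [sub_add_cancel, hermitianCpow_one (posSemidef_conjTranspose_mul_self K)] at hT
  rw [← hT, hK]
  simp only [Matrix.mul_assoc]

lemma hermitianRpow_posSemidef {M : Matrix n n ℂ} (hM : M.PosSemidef) (q : ℝ) :
    (hermitianRpow M hM.1 q).PosSemidef := by
  unfold hermitianRpow
  refine PosSemidef.mul_mul_conjTranspose_same (PosSemidef.diagonal fun i => ?_) _
  exact Complex.zero_le_real.2 (Real.rpow_nonneg (hM.eigenvalues_nonneg i) q)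

lemma absRpow_posSemidef (X : Matrix m n ℂ) (q : ℝ) : (absRpow X q).PosSemidef :=
  hermitianRpow_posSemidef (posSemidef_conjTranspose_mul_self X) _

lemma trace_mul_nonneg_of_posSemidef {A B : Matrix n n ℂ} (hA : A.PosSemidef)
    (hB : B.PosSemidef) : 0 ≤ (A * B).trace := by
  have h : (hermitianCpow A hA.1 (1 / 2))ᴴ = hermitianCpow A hA.1 (1 / 2) := by
    rw [conjTranspose_hermitianCpow]
    simp
  have h2 := (hB.mul_mul_conjTranspose_same (hermitianCpow A hA.1 (1 / 2))).trace_nonneg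
  rwa [h, Matrix.trace_mul_comm, ← Matrix.mul_assoc, hermitianCpow_mul, add_halves,
    hermitianCpow_one hA] at h2

variable [DecidableEq m]

lemma norm_conjTranspose_le_one {C : Matrix n m ℂ} (h : ‖C‖ ≤ 1) : ‖Cᴴ‖ ≤ 1 := by
  rwa [Matrix.l2_opNorm_conjTranspose]

lemma norm_hermitianCpow_mul_conjTranspose_le_one (X : Matrix m n ℂ) {s : ℂ}
    (hs : s.re = -1 / 2) :
    ‖hermitianCpow (Xᴴ * X) (posSemidef_conjTranspose_mul_self X).1 s * Xᴴ‖ ≤ 1 := by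
  have h := norm_conjTranspose_le_one (norm_mul_hermitianCpow_le_one X (s := star s) (by simpa))
  rwa [Matrix.conjTranspose_mul, conjTranspose_hermitianCpow, star_star] at h

lemma norm_threeLinesFun_le_of_re_eq_zero (K : Matrix n n ℂ) (F : Matrix n m ℂ)
    (H : Matrix m m ℂ) {q : ℝ}
    (hq : 0 < q) {z : ℂ} (hz : z.re = 0) :
    ‖threeLinesFun K F H q z‖ ≤ (absRpow K q).trace.re := by
  rw [absRpow_eq_hermitianCpow _ hq]
  unfold threeLinesFun
  set hK := (posSemidef_conjTranspose_mul_self K).1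
  have hw : (((q : ℂ) * z - 1) / 2).re = -1 / 2 := by simp [hz]
  have hv : (-(1 + (q : ℂ) * z) / 2).re = -1 / 2 := by simp [hz]
  have hq4 : star ((q : ℂ) / 4) = (q : ℂ) / 4 := by simp
  have hC := norm_mul_le_one_of_le_one (norm_mul_le_one_of_le_one (norm_mul_le_one_of_le_one
    (norm_hermitianCpow_mul_conjTranspose_le_one K hv) (norm_mul_hermitianCpow_le_one F hw))
    (norm_mul_hermitianCpow_le_one H hw)) (norm_hermitianCpow_mul_conjTranspose_le_one F hw)
  have h := norm_trace_mul_mul_le hC (hermitianCpow (Kᴴ * K) hK ((q : ℂ) / 4))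
    (hermitianCpow (Kᴴ * K) hK ((q : ℂ) / 4))
  rw [Matrix.mul_assoc, Matrix.trace_mul_comm, conjTranspose_hermitianCpow, hq4,
    hermitianCpow_mul, add_self_div_two, show (q : ℂ) / 4 + q / 4 = q / 2 by ring] at h
  refine le_trans (le_of_eq ?_) h
  rw [show ((q : ℂ) - 1 - q * z) / 2 = q / 2 + -(1 + q * z) / 2 by ring, ← hermitianCpow_mul]
  simp only [Matrix.mul_assoc]

lemma norm_threeLinesFun_le_of_re_eq_one (K : Matrix n n ℂ) (F : Matrix n m ℂ)
    (H : Matrix m m ℂ) {q : ℝ}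
    (hq : 0 < q) {z : ℂ} (hz : z.re = 1) :
    ‖threeLinesFun K F H q z‖ ≤
      (hermitianRpow (Fᴴ * F) (Matrix.posSemidef_conjTranspose_mul_self F).1 q *
        ((1 / 2 : ℂ) • (absRpow H q + absRpow Hᴴ q))).trace.re := by
  rw [absRpow_eq_hermitianCpow _ hq, absRpow_eq_hermitianCpow _ hq,
    hermitianRpow_eq_hermitianCpow (posSemidef_conjTranspose_mul_self F) hq]
  unfold threeLinesFun
  set hF := (posSemidef_conjTranspose_mul_self F).1
  set hH := (posSemidef_conjTranspose_mul_self H).1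
  have hv : (((q : ℂ) - 1 - q * z) / 2).re = -1 / 2 := by simp [hz]
  have hu : (-1 / 2 : ℂ).re = -1 / 2 := by norm_num
  have hs : ((q : ℂ) * z / 2).re = q / 2 := by simp [hz]
  have hs' : (star ((q : ℂ) * z / 2)).re = q / 2 := by simp [hz]
  have hC := norm_mul_le_one_of_le_one (norm_hermitianCpow_mul_conjTranspose_le_one F hu)
    (norm_mul_le_one_of_le_one (norm_hermitianCpow_mul_conjTranspose_le_one K hv)
    (norm_mul_hermitianCpow_le_one F hu))
  have h := norm_trace_mul_mul_le hC
    (hermitianCpow (Fᴴ * F) hF (q * z / 2) *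
      (H * hermitianCpow (Hᴴ * H) hH ((q : ℂ) / 4 - 1 / 2)))
    (hermitianCpow (Hᴴ * H) hH (q * z / 2 - q / 4) * hermitianCpow (Fᴴ * F) hF (q * z / 2))
  have hX : ((hermitianCpow (Fᴴ * F) hF (q * z / 2) *
      (H * hermitianCpow (Hᴴ * H) hH ((q : ℂ) / 4 - 1 / 2))) *
      (hermitianCpow (Fᴴ * F) hF (q * z / 2) *
      (H * hermitianCpow (Hᴴ * H) hH ((q : ℂ) / 4 - 1 / 2)))ᴴ).trace =
      (hermitianCpow (Fᴴ * F) hF q * hermitianCpow (Hᴴᴴ * Hᴴ)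
        (posSemidef_conjTranspose_mul_self Hᴴ).1 (q / 2)).trace := by
    rw [← trace_hermitianCpow_conj hF _ hs,
      show (q : ℂ) / 2 = (q / 4 - 1 / 2 + star ((q : ℂ) / 4 - 1 / 2)) + 1 by simp; ring,
      ← mul_hermitianCpow_mul_conjTranspose, ← hermitianCpow_mul]
    simp only [Matrix.conjTranspose_mul, conjTranspose_hermitianCpow, Matrix.mul_assoc]
  have hY : ((hermitianCpow (Hᴴ * H) hH (q * z / 2 - q / 4) *
      hermitianCpow (Fᴴ * F) hF (q * z / 2))ᴴ *
      (hermitianCpow (Hᴴ * H) hH (q * z / 2 - q / 4) *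
      hermitianCpow (Fᴴ * F) hF (q * z / 2))).trace =
      (hermitianCpow (Fᴴ * F) hF q * hermitianCpow (Hᴴ * H) hH (q / 2)).trace := by
    have e : (q : ℂ) / 2 = star ((q : ℂ) * z / 2 - q / 4) + (q * z / 2 - q / 4) := by
      apply Complex.ext
      · simp [hz]; ring
      · simp; ring
    rw [← trace_hermitianCpow_conj hF _ hs', star_star, e, ← hermitianCpow_mul]
    simp only [Matrix.conjTranspose_mul, conjTranspose_hermitianCpow, Matrix.mul_assoc]
  rw [hX, hY] at h
  refine le_trans (le_of_eq ?_) (h.trans (le_of_eq ?_))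
  · rw [show ((q : ℂ) * z - 1) / 2 = -1 / 2 + q * z / 2 by ring, ← hermitianCpow_mul hF,
      show (-1 / 2 : ℂ) + q * z / 2 = (q / 4 - 1 / 2) + (q * z / 2 - q / 4) by ring,
      ← hermitianCpow_mul hH]
    have hcomm : hermitianCpow (Fᴴ * F) hF (-1 / 2) * hermitianCpow (Fᴴ * F) hF (q * z / 2) =
        hermitianCpow (Fᴴ * F) hF (q * z / 2) * hermitianCpow (Fᴴ * F) hF (-1 / 2) := by
      rw [hermitianCpow_mul, hermitianCpow_mul, add_comm]
    conv_rhs => rw [Matrix.mul_assoc, Matrix.mul_assoc, Matrix.trace_mul_comm]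
    conv_lhs => enter [1, 1, 2]; rw [hcomm]
    simp only [Matrix.mul_assoc]
  · simp [Matrix.mul_add]
    ring

lemma le_of_le_rpow_mul_rpow {x y t : ℝ} (hx : 0 ≤ x) (hy : 0 ≤ y) (ht : 0 < t) (ht' : t ≤ 1)
    (h : x ≤ x ^ (1 - t) * y ^ t) : x ≤ y := by
  have := Real.geom_mean_le_arith_mean2_weighted (sub_nonneg.2 ht') ht.le hx hy (by ring)
  have h2 : t * x ≤ t * y := by linarith
  exact le_of_mul_le_mul_left h2 ht

end

/-- an Araki–Lieb–Thirring type inequality for a general middle factor: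
`Tr |F H F†|^q ≤ Tr[(F†F)^q (|H|^q + |H†|^q)/2]` for `q ≥ 1`. -/
theorem trace_absRpow_le (n m : ℕ) (q : ℝ) (hq : 1 ≤ q)
    (F : Matrix (Fin n) (Fin m) ℂ) (H : Matrix (Fin m) (Fin m) ℂ) :
    (absRpow (F * H * Fᴴ) q).trace ≤
      (hermitianRpow (Fᴴ * F) (Matrix.posSemidef_conjTranspose_mul_self F).1 q *
        ((1 / 2 : ℂ) • (absRpow H q + absRpow Hᴴ q))).trace := by
  have hq0 : 0 < q := one_pos.trans_le hq
  have hx := (absRpow_posSemidef (F * H * Fᴴ) q).trace_nonneg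
  have hy := trace_mul_nonneg_of_posSemidef
    (hermitianRpow_posSemidef (posSemidef_conjTranspose_mul_self F) q)
    (((absRpow_posSemidef H q).add (absRpow_posSemidef Hᴴ q)).smul
      (show (0 : ℂ) ≤ 1 / 2 by positivity))
  obtain ⟨hd, B, hB⟩ := entireBddOnStrip_threeLinesFun (F * H * Fᴴ) F H q
  have hinv : q⁻¹ ∈ Set.Icc (0 : ℝ) 1 := ⟨by positivity, inv_le_one_of_one_le₀ hq⟩
  have h := Complex.HadamardThreeLines.norm_le_interp_of_mem_verticalClosedStrip'
    (f := threeLinesFun (F * H * Fᴴ) F H q) (z := ((q⁻¹ : ℝ) : ℂ)) zero_lt_one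
    (by simpa only [Complex.HadamardThreeLines.verticalClosedStrip, Set.mem_preimage,
      Complex.ofReal_re] using hinv)
    hd.diffContOnCl
    ⟨B, by rintro _ ⟨z, hz, rfl⟩; exact hB z hz.1 hz.2⟩
    (fun z hz => norm_threeLinesFun_le_of_re_eq_zero _ F H hq0 hz)
    (fun z hz => norm_threeLinesFun_le_of_re_eq_one _ F H hq0 hz)
  rw [threeLinesFun_inv F H hq0, Complex.ofReal_re, sub_zero, sub_zero, div_one] at h
  rw [Complex.le_def]
  exact ⟨le_of_le_rpow_mul_rpow (Complex.le_def.1 hx).1 (Complex.le_def.1 hy).1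
    (inv_pos.2 hq0) hinv.2 ((Complex.re_le_norm _).trans h),
    (Complex.le_def.1 hx).2.symm.trans (Complex.le_def.1 hy).2⟩
end

section
/- For every b ∈ (0,1) there exists p > 2 such that, with G_1 = X_1 = Diag(1, b) and G_2 = X_2 = Diag(b, −1), one has ‖G_1 ⊗ X_1 + G_2 ⊗ X_2‖_p > max_{θ∈[0,2π)} ‖ ‖X_1‖_p · G_1 + e^{iθ} ‖X_2‖_p · G_2 ‖_p. Equivalently, for every b ∈ (0,1) there exists p > 2 with 2(1+b²)^p > (1+b^p)·((1+b)^p + (1−b)^p). Hence the conjectured inequality (3) of the paper fails in general for 2q slightly larger than 2. -/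
open scoped Kronecker ComplexOrder
open Matrix

open Real in
theorem sub_mul_log_pos {u : ℝ} (hu : 0 < u) (hu1 : u < 1) :
    0 < -(2 + u) * log (1 + u) - (2 - u) * log (1 - u) := by
  have hd : ∀ x : ℝ, 0 ≤ x → x < 1 →
      HasDerivAt (fun x : ℝ => -(2 + x) * log (1 + x) - (2 - x) * log (1 - x))
        (2 * x / (1 - x ^ 2) - log ((1 + x) / (1 - x))) x := by
    intro x h0 h1
    have hp : HasDerivAt (fun x : ℝ => 1 + x) 1 x := (hasDerivAt_id x).const_add 1
    have hm : HasDerivAt (fun x : ℝ => 1 - x) (-1) x := (hasDerivAt_id x).const_sub 1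
    have hp2 : HasDerivAt (fun x : ℝ => -(2 + x)) (-1) x := ((hasDerivAt_id x).const_add 2).neg
    have hm2 : HasDerivAt (fun x : ℝ => 2 - x) (-1) x := (hasDerivAt_id x).const_sub 2
    have a1 : 1 + x ≠ 0 := by linarith
    have a2 : 1 - x ≠ 0 := by linarith
    refine ((hp2.mul (hp.log a1)).sub (hm2.mul (hm.log a2))).congr_deriv ?_
    rw [log_div a1 a2]
    have : 1 - x ^ 2 = (1 + x) * (1 - x) := by ring
    rw [this]
    field_simp
    ring
  have hmono : StrictMonoOn (fun x : ℝ => -(2 + x) * log (1 + x) - (2 - x) * log (1 - x))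
      (Set.Ico 0 1) := by
    refine strictMonoOn_of_deriv_pos (convex_Ico 0 1)
      (fun x hx => (hd x hx.1 hx.2).continuousAt.continuousWithinAt) fun x hx => ?_
    rw [interior_Ico] at hx
    rw [(hd x hx.1.le hx.2).deriv]
    have h1 : 0 < 1 - x := by linarith [hx.2]
    have h2 : 0 < 1 + x := by linarith [hx.1]
    have hr : 1 < (1 + x) / (1 - x) := by
      rw [one_lt_div h1]; linarith [hx.1]
    have := self_lt_sinh_iff.2 (log_pos hr)
    rw [sinh_log (by positivity)] at this
    have e : ((1 + x) / (1 - x) - ((1 + x) / (1 - x))⁻¹) / 2 = 2 * x / (1 - x ^ 2) := by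
      have : 1 - x ^ 2 = (1 + x) * (1 - x) := by ring
      rw [this]
      field_simp
      ring
    linarith
  simpa using hmono (Set.left_mem_Ico.2 one_pos) ⟨hu.le, hu1⟩ hu

open Real in
theorem one_add_mul_log_add_lt {u : ℝ} (hu : 0 < u) (hu1 : u < 1) :
    (1 + u) * log (1 + u) + (1 - u) * log (1 - u) < 2 * log 2 * u ^ 2 := by
  have hmono : StrictMonoOn
      (fun x : ℝ => ((1 + x) * log (1 + x) + (1 - x) * log (1 - x)) / x ^ 2) (Set.Ioc 0 1) := by
    refine strictMonoOn_of_deriv_pos (convex_Ioc 0 1) ?_ fun x hx => ?_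
    · refine ContinuousOn.div (Continuous.continuousOn ?_) (by fun_prop)
        fun x hx => (pow_pos hx.1 2).ne'
      exact (continuous_mul_log.comp (continuous_const.add continuous_id)).add
        (continuous_mul_log.comp (continuous_const.sub continuous_id))
    · rw [interior_Ioc] at hx
      have h0 := hx.1
      have hp : HasDerivAt (fun x : ℝ => 1 + x) 1 x := (hasDerivAt_id x).const_add 1
      have hm : HasDerivAt (fun x : ℝ => 1 - x) (-1) x := (hasDerivAt_id x).const_sub 1
      have a1 : 1 + x ≠ 0 := by linarith
      have a2 : 1 - x ≠ 0 := by linarith [hx.2]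
      have hD := ((hp.mul (hp.log a1)).add (hm.mul (hm.log a2))).div (hasDerivAt_pow 2 x)
        (pow_pos hx.1 2).ne'
      have hD' := hD.deriv
      have e : deriv (fun x : ℝ => ((1 + x) * log (1 + x) + (1 - x) * log (1 - x)) / x ^ 2) x
          = (-(2 + x) * log (1 + x) - (2 - x) * log (1 - x)) / x ^ 3 := by
        refine hD'.trans ?_
        simp only [Pi.add_apply, Pi.mul_apply]
        field_simp
        push_cast
        ring
      rw [e]
      exact div_pos (sub_mul_log_pos hx.1 hx.2) (pow_pos hx.1 3)
  have := hmono ⟨hu, hu1.le⟩ (Set.right_mem_Ioc.2 one_pos) hu1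
  norm_num at this
  rwa [div_lt_iff₀ (by positivity)] at this

open Real in
theorem entropic_uncertainty {b : ℝ} (hb : 0 < b) (hb1 : b < 1) :
    2 * b ^ 2 * log b + (1 + b) ^ 2 * log (1 + b) + (1 - b) ^ 2 * log (1 - b) <
      2 * (1 + b ^ 2) * log (1 + b ^ 2) := by
  have hs : 0 < 1 + b ^ 2 := by positivity
  have hp : 0 < 1 + b := by linarith
  have hm : 0 < 1 - b := by linarith
  have hu := one_add_mul_log_add_lt (u := (1 - b ^ 2) / (1 + b ^ 2))
    (div_pos (by nlinarith) hs) (by rw [div_lt_one hs]; nlinarith)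
  have hv := one_add_mul_log_add_lt (u := 2 * b / (1 + b ^ 2))
    (by positivity) (by rw [div_lt_one hs]; nlinarith [sq_pos_of_pos hm])
  have e1 : 1 + (1 - b ^ 2) / (1 + b ^ 2) = 2 / (1 + b ^ 2) := by field_simp; ring
  have e2 : 1 - (1 - b ^ 2) / (1 + b ^ 2) = 2 * b ^ 2 / (1 + b ^ 2) := by field_simp; ring
  have e3 : 1 + 2 * b / (1 + b ^ 2) = (1 + b) ^ 2 / (1 + b ^ 2) := by field_simp; ring
  have e4 : 1 - 2 * b / (1 + b ^ 2) = (1 - b) ^ 2 / (1 + b ^ 2) := by field_simp; ring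
  rw [e1, e2, log_div two_ne_zero hs.ne', log_div (by positivity) hs.ne',
    log_mul two_ne_zero (by positivity), log_pow] at hu
  rw [e3, e4, log_div (by positivity) hs.ne', log_div (by positivity) hs.ne', log_pow,
    log_pow] at hv
  have key := mul_lt_mul_of_pos_right (add_lt_add hu hv) hs
  push_cast at key
  have e5 : (2 * log 2 * ((1 - b ^ 2) / (1 + b ^ 2)) ^ 2 +
      2 * log 2 * (2 * b / (1 + b ^ 2)) ^ 2) * (1 + b ^ 2) = 2 * log 2 * (1 + b ^ 2) := by
    field_simp; ring
  rw [e5] at key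
  field_simp at key
  linarith

open Real in
theorem exists_two_lt_rpow_lt {b : ℝ} (hb : 0 < b) (hb1 : b < 1) :
    ∃ p : ℝ, 2 < p ∧
      (1 + b ^ p) * ((1 + b) ^ p + (1 - b) ^ p) < 2 * (1 + b ^ 2) ^ p := by
  have hs : 0 < 1 + b ^ 2 := by positivity
  have hp : 0 < 1 + b := by linarith
  have hm : 0 < 1 - b := by linarith
  have hpow : ∀ a : ℝ, 0 < a → HasDerivAt (fun p : ℝ => a ^ p) (a ^ 2 * log a) 2 := by
    intro a ha
    simpa using (hasStrictDerivAt_const_rpow ha 2).hasDerivAt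
  have hD := ((hpow _ hs).const_mul 2).sub
    (((hpow b hb).const_add 1).mul ((hpow _ hp).add (hpow _ hm)))
  have hev := hD.tendsto_slope.eventually_const_lt (u := 0) (by
    have := mul_pos hs (sub_pos.2 (entropic_uncertainty hb hb1))
    simp only [Pi.add_apply, rpow_ofNat]
    linarith)
  obtain ⟨p, hp0, hp2⟩ := ((hev.filter_mono (nhdsWithin_mono 2
    (fun x (hx : x ∈ Set.Ioi (2 : ℝ)) => ne_of_gt hx))).and self_mem_nhdsWithin).exists
  refine ⟨p, hp2, ?_⟩
  have hp2' : 0 < p - 2 := sub_pos.2 hp2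
  rw [slope_def_field, div_pos_iff_of_pos_right hp2'] at hp0
  simp only [Pi.sub_apply, Pi.mul_apply, Pi.add_apply, rpow_ofNat] at hp0
  linarith

theorem rpow_add_rpow_sub_le {s c m r : ℝ} (hr : 1 ≤ r) (hm : 0 < m) (hms : m ≤ s)
    (hc : |c| ≤ m) : (s + c) ^ r + (s - c) ^ r ≤ (s + m) ^ r + (s - m) ^ r := by
  have hcv := convexOn_rpow hr
  have hc' := abs_le.1 hc
  have h1 : 0 ≤ (m + c) / (2 * m) := div_nonneg (by linarith) (by linarith)
  have h2 : 0 ≤ (m - c) / (2 * m) := div_nonneg (by linarith) (by linarith)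
  have h3 : (m + c) / (2 * m) + (m - c) / (2 * m) = 1 := by field_simp; ring
  have hp : s + m ∈ Set.Ici (0 : ℝ) := Set.mem_Ici.2 (by linarith)
  have hn : s - m ∈ Set.Ici (0 : ℝ) := Set.mem_Ici.2 (by linarith)
  have k1 := hcv.2 hp hn h1 h2 h3
  have k2 := hcv.2 hp hn h2 h1 (by rw [add_comm, h3])
  have e1 : (m + c) / (2 * m) * (s + m) + (m - c) / (2 * m) * (s - m) = s + c := by
    field_simp; ring
  have e2 : (m - c) / (2 * m) * (s + m) + (m + c) / (2 * m) * (s - m) = s - c := by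
    field_simp; ring
  simp only [smul_eq_mul, e1, e2] at k1 k2
  linear_combination k1 + k2 + ((s + m) ^ r + (s - m) ^ r) * h3

theorem schattenNorm_diagonal {n : Type*} [Fintype n] [DecidableEq n] (q : ℝ) (d : n → ℂ) :
    schattenNorm q (Matrix.diagonal d) = (∑ i, ‖d i‖ ^ q) ^ (1 / q) := by
  unfold schattenNorm
  congr 1
  have hA := (Matrix.posSemidef_conjTranspose_mul_self (Matrix.diagonal d)).1
  have hroots := hA.roots_charpoly_eq_eigenvalues
  have hdiag : (Matrix.diagonal d)ᴴ * Matrix.diagonal d =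
      Matrix.diagonal fun i => ((‖d i‖ ^ 2 : ℝ) : ℂ) := by
    rw [Matrix.diagonal_conjTranspose, Matrix.diagonal_mul_diagonal]
    congr 1
    ext i
    simp [Complex.conj_mul']
  have hroots' : ((Matrix.diagonal d)ᴴ * Matrix.diagonal d).charpoly.roots =
      Multiset.map (fun i => ((‖d i‖ ^ 2 : ℝ) : ℂ)) Finset.univ.val := by
    rw [hdiag, Matrix.charpoly_diagonal, Polynomial.roots_prod]
    · simp only [Polynomial.roots_X_sub_C, Multiset.bind_singleton]
    · exact Finset.prod_ne_zero_iff.2 fun i _ => Polynomial.X_sub_C_ne_zero _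
  have h := congrArg (fun M => (M.map fun z : ℂ => z.re ^ (q / 2)).sum) (hroots.symm.trans hroots')
  simp only [Multiset.map_map] at h
  refine h.trans ?_
  refine Finset.sum_congr rfl fun i _ => ?_
  simp only [Function.comp_apply, Complex.ofReal_re]
  rw [← Real.rpow_natCast, ← Real.rpow_mul (norm_nonneg _)]
  congr 1
  push_cast
  ring

theorem norm_one_add_mul_rpow_add_le {b p : ℝ} (hb : 0 < b) (hp : 2 ≤ p) (hb1 : b ≤ 1)
    {z : ℂ} (hz : ‖z‖ = 1) :
    ‖1 + z * b‖ ^ p + ‖b - z‖ ^ p ≤ (1 + b) ^ p + (1 - b) ^ p := by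
  have hsq : ∀ x : ℝ, 0 ≤ x → x ^ p = (x ^ 2) ^ (p / 2) := by
    intro x hx
    rw [← Real.rpow_natCast, ← Real.rpow_mul hx]
    congr 1
    push_cast
    ring
  have hz2 : z.re ^ 2 + z.im ^ 2 = 1 := by
    have := Complex.sq_norm z
    rw [hz, Complex.normSq_apply] at this
    linarith
  have e1 : ‖1 + z * b‖ ^ 2 = (1 + b ^ 2) + 2 * b * z.re := by
    rw [Complex.sq_norm, Complex.normSq_apply]
    simp
    linear_combination b ^ 2 * hz2
  have e2 : ‖b - z‖ ^ 2 = (1 + b ^ 2) - 2 * b * z.re := by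
    rw [Complex.sq_norm, Complex.normSq_apply]
    simp
    linear_combination hz2
  rw [hsq _ (norm_nonneg _), hsq _ (norm_nonneg _), hsq (1 + b) (by linarith),
    hsq (1 - b) (by linarith), e1, e2]
  have hre : |z.re| ≤ 1 := hz ▸ Complex.abs_re_le_norm z
  convert rpow_add_rpow_sub_le (s := 1 + b ^ 2) (c := 2 * b * z.re) (m := 2 * b) (r := p / 2)
    (by linarith) (by linarith) (by nlinarith [sq_nonneg (1 - b)])
    (by rw [abs_mul, abs_of_pos (by linarith : 0 < 2 * b)]; nlinarith) using 3 <;> ring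

/-- the counterexample to inequality (3): for every `b ∈ (0,1)` there is a
`p > 2` such that, with `G₁ = X₁ = Diag(1, b)` and `G₂ = X₂ = Diag(b, −1)`,
`‖G₁ ⊗ X₁ + G₂ ⊗ X₂‖_p > max_θ ‖‖X₁‖_p G₁ + e^{iθ} ‖X₂‖_p G₂‖_p`; equivalently
`2(1+b²)^p > (1+b^p)((1+b)^p + (1−b)^p)`. -/
theorem counterexample_to_conjecture :
    ∀ b : ℝ, 0 < b → b < 1 →
      ∃ p : ℝ, 2 < p ∧
        (schattenNorm p
            ((Matrix.diagonal ![1, (b : ℂ)]) ⊗ₖ (Matrix.diagonal ![1, (b : ℂ)]) +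
              (Matrix.diagonal ![(b : ℂ), -1]) ⊗ₖ (Matrix.diagonal ![(b : ℂ), -1])) >
          ⨆ θ : Set.Ico (0 : ℝ) (2 * Real.pi),
            schattenNorm p
              ((schattenNorm p (Matrix.diagonal ![1, (b : ℂ)]) : ℂ) • Matrix.diagonal ![1, (b : ℂ)] +
                (Complex.exp ((θ : ℝ) * Complex.I) *
                  (schattenNorm p (Matrix.diagonal ![(b : ℂ), -1]) : ℂ)) • Matrix.diagonal ![(b : ℂ), -1])) ∧
        2 * (1 + b ^ 2) ^ p > (1 + b ^ p) * ((1 + b) ^ p + (1 - b) ^ p) := by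
  intro b hb hb1
  obtain ⟨p, hp, hlt⟩ := exists_two_lt_rpow_lt hb hb1
  refine ⟨p, hp, ?_, hlt⟩
  have hp0 : p ≠ 0 := by linarith
  have hX1 : schattenNorm p (Matrix.diagonal ![1, (b : ℂ)]) = (1 + b ^ p) ^ (1 / p) := by
    simp [schattenNorm_diagonal, abs_of_pos hb]
  have hX2 : schattenNorm p (Matrix.diagonal ![(b : ℂ), -1]) = (1 + b ^ p) ^ (1 / p) := by
    simp [schattenNorm_diagonal, abs_of_pos hb, add_comm]
  have hL : schattenNorm p
      ((Matrix.diagonal ![1, (b : ℂ)]) ⊗ₖ (Matrix.diagonal ![1, (b : ℂ)]) +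
        (Matrix.diagonal ![(b : ℂ), -1]) ⊗ₖ (Matrix.diagonal ![(b : ℂ), -1])) =
      (2 * (1 + b ^ 2) ^ p) ^ (1 / p) := by
    have e1 : ‖1 + (b : ℂ) * b‖ = 1 + b ^ 2 := by
      rw [show 1 + (b : ℂ) * b = ((1 + b ^ 2 : ℝ) : ℂ) by push_cast; ring,
        Complex.norm_of_nonneg (by positivity)]
    have e2 : ‖(b : ℂ) * b + 1‖ = 1 + b ^ 2 := by rw [add_comm, e1]
    rw [Matrix.diagonal_kronecker_diagonal, Matrix.diagonal_kronecker_diagonal,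
      Matrix.diagonal_add, schattenNorm_diagonal, Fintype.sum_prod_type]
    simp [e1, e2, hp0, two_mul]
  rw [hL, hX1, hX2]
  have hN : 0 ≤ 1 + b ^ p := by positivity
  have hm : 0 ≤ 1 - b := by linarith
  refine lt_of_le_of_lt (b := ((1 + b ^ p) * ((1 + b) ^ p + (1 - b) ^ p)) ^ (1 / p)) ?_
    (Real.rpow_lt_rpow (by positivity) hlt (by positivity))
  have : Nonempty (Set.Ico (0 : ℝ) (2 * Real.pi)) := ⟨0, le_rfl, by positivity⟩
  refine ciSup_le fun θ => ?_
  set N : ℝ := (1 + b ^ p) ^ (1 / p) with hNdef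
  have hN0 : 0 ≤ N := by positivity
  have hNp : N ^ p = 1 + b ^ p := by
    rw [hNdef, ← Real.rpow_mul hN, one_div_mul_cancel hp0, Real.rpow_one]
  set z := Complex.exp ((θ : ℝ) * Complex.I)
  have hz : ‖z‖ = 1 := Complex.norm_exp_ofReal_mul_I _
  have hdiag : (N : ℂ) • Matrix.diagonal ![1, (b : ℂ)] +
      (z * (N : ℂ)) • Matrix.diagonal ![(b : ℂ), -1] =
      Matrix.diagonal ![(N : ℂ) * (1 + z * b), N * (b - z)] := by
    rw [← Matrix.diagonal_smul, ← Matrix.diagonal_smul, Matrix.diagonal_add]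
    congr 1
    ext i
    fin_cases i <;> simp <;> ring
  rw [hdiag, schattenNorm_diagonal]
  refine Real.rpow_le_rpow (Finset.sum_nonneg fun i _ => by positivity) ?_ (by positivity)
  simp only [Fin.sum_univ_two, Matrix.cons_val_zero, Matrix.cons_val_one, norm_mul,
    Complex.norm_of_nonneg hN0]
  rw [Real.mul_rpow hN0 (norm_nonneg _), Real.mul_rpow hN0 (norm_nonneg _), hNp, ← mul_add]
  exact mul_le_mul_of_nonneg_left (norm_one_add_mul_rpow_add_le hb hp.le hb1.le hz) hN
end
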